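/- Let G = W_1 × W_2 × ⋯ × W_n be a direct product of n irreducible, infinite, non-affine Coxeter groups of finite rank, and let H be a subgroup of G of finite index. Then H has trivial center, and H can be expressed as an internal direct product H = H_1 × ⋯ × H_m of nontrivial subgroups each of which cannot be further decomposed as a direct product of two nontrivial subgroups; moreover 1 ≤ m ≤ n and this decomposition is unique up to rearrangement of the factors. -/

import Mathlib

namespace CoxeterPaper

/-- The entry `-cos (π / m i j)` of the matrix of the standard bilinear form,
interpreted as `-1` when `m i j = ∞` (encoded as `0`). -/
noncomputable def formEntry {B : Type*} (M : CoxeterMatrix B) (i j : B) : ℝ :=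
  if M i j = 0 then -1 else - Real.cos (Real.pi / (M i j : ℝ))

/-- The standard bilinear form associated to a Coxeter matrix, on `V = B → ℝ`
(with basis `{α_s : s ∈ S}` identified with the standard basis). -/
noncomputable def bilin {B : Type*} [Fintype B] (M : CoxeterMatrix B) (v w : B → ℝ) : ℝ :=
  ∑ i, ∑ j, v i * w j * formEntry M i j

/-- The standard bilinear form is positive definite. -/
def IsPosDef {B : Type*} [Fintype B] (M : CoxeterMatrix B) : Prop :=
  ∀ v : B → ℝ, v ≠ 0 → 0 < bilin M v v

/-- The standard bilinear form is positive semidefinite. -/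
def IsPosSemidef {B : Type*} [Fintype B] (M : CoxeterMatrix B) : Prop :=
  ∀ v : B → ℝ, 0 ≤ bilin M v v

/-- The Coxeter graph: vertices are the elements of `B`, and `i ≠ j` are adjacent
iff `m i j ≥ 3` (including `m i j = ∞`, encoded as `0`), i.e. iff `m i j ≠ 2`. -/
def coxeterGraph {B : Type*} (M : CoxeterMatrix B) : SimpleGraph B :=
  SimpleGraph.fromRel fun i j => M i j ≠ 2

/-- A Coxeter matrix (system) is irreducible if its Coxeter graph is connected. -/
def IsIrreducible {B : Type*} (M : CoxeterMatrix B) : Prop := (coxeterGraph M).Connected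

/-- An internal direct product decomposition of a group `G` into a family of
subgroups: each factor is normal, together they generate `G`, and each factor
meets the subgroup generated by the remaining factors trivially. -/
def IsInternalDirectProduct {G : Type*} [Group G] {ι : Type*} (K : ι → Subgroup G) : Prop :=
  (∀ i, (K i).Normal) ∧ (⨆ i, K i) = ⊤ ∧ (∀ i, K i ⊓ (⨆ j ∈ {j | j ≠ i}, K j) = ⊥)

/-- A group cannot be decomposed as an internal direct product of two nontrivial
subgroups. -/
def Indecomposable (G : Type*) [Group G] : Prop :=
  ∀ A B : Subgroup G, A.Normal → B.Normal → A ⊓ B = ⊥ → A ⊔ B = ⊤ → A = ⊥ ∨ B = ⊥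

/-- A real quadratic polynomial that is nonpositive at all powers of some `c > 1`
has nonpositive leading coefficient. -/
theorem leading_nonpos_of_pow {c x y z : ℝ} (hc : 1 < c)
    (h : ∀ n : ℕ, x * (c ^ n) ^ 2 + y * c ^ n + z ≤ 0) : x ≤ 0 := by
  by_contra! hx
  obtain ⟨n, hn⟩ := pow_unbounded_of_one_lt ((|y| + |z|) / x + 1) hc
  have h1 : 1 ≤ c ^ n := one_le_pow₀ hc.le
  have h2 := h n
  have h3 : |y| + |z| < x * c ^ n := by
    have : (|y| + |z|) / x < c ^ n := by linarith
    rwa [div_lt_iff₀ hx, mul_comm] at this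
  have h4 := neg_abs_le y
  have h5 := neg_abs_le z
  nlinarith [abs_nonneg y, abs_nonneg z]

theorem eq_zero_of_pow_roots {c : ℝ} (hc : 1 < c) {a₀ a₁ a₂ a₃ a₄ : ℝ}
    (h : ∀ n : ℕ, a₄ * (c ^ n) ^ 4 + a₃ * (c ^ n) ^ 3 + a₂ * (c ^ n) ^ 2 + a₁ * c ^ n + a₀ = 0) :
    a₄ = 0 ∧ a₃ = 0 := by
  open Polynomial in
  let p : ℝ[X] := C a₄ * X ^ 4 + C a₃ * X ^ 3 + C a₂ * X ^ 2 + C a₁ * X + C a₀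
  have hp : p = 0 := by
    apply Polynomial.eq_zero_of_infinite_isRoot
    refine (Set.infinite_range_of_injective (pow_right_injective₀ (by linarith) hc.ne')).mono ?_
    rintro _ ⟨n, rfl⟩
    simpa [p] using h n
  have h4 : p.coeff 4 = a₄ := by simp [p]
  have h3 : p.coeff 3 = a₃ := by simp [p]
  simp_all

theorem eq_zero_or_of_mul_eq_zero {E : Type*} [AddCommGroup E] [Module ℝ E]
    (f g : E →ₗ[ℝ] ℝ) (h : ∀ z, f z * g z = 0) : f = 0 ∨ g = 0 := by
  by_contra! hfg
  obtain ⟨x, hx⟩ := DFunLike.ne_iff.1 hfg.1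
  obtain ⟨y, hy⟩ := DFunLike.ne_iff.1 hfg.2
  simp only [LinearMap.zero_apply] at hx hy
  have h1 : g x = 0 := by simpa [hx] using h x
  have h2 : f y = 0 := by simpa [hy] using h y
  have h3 := h (x + y)
  simp [h1, h2, hx, hy] at h3

theorem exists_eq_smul_of_ker_le {E : Type*} [AddCommGroup E] [Module ℝ E]
    (f g : E →ₗ[ℝ] ℝ) (h : ∀ z, f z = 0 → g z = 0) : ∃ c : ℝ, g = c • f := by
  by_cases hf : f = 0
  · exact ⟨0, by ext z; simpa using h z (by simp [hf])⟩
  obtain ⟨x, hx⟩ := DFunLike.ne_iff.1 hf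
  simp only [LinearMap.zero_apply] at hx
  refine ⟨g x / f x, ?_⟩
  ext z
  have := h (z - (f z / f x) • x) (by simp [hx])
  simp only [map_sub, map_smul, smul_eq_mul] at this
  simp only [LinearMap.smul_apply, smul_eq_mul]
  field_simp at this ⊢
  linarith

/-- Unique factorization for products of two linear forms. -/
theorem eq_smul_of_mul_eq_mul {E : Type*} [AddCommGroup E] [Module ℝ E]
    {f₁ f₂ f₃ f₄ : E →ₗ[ℝ] ℝ} (h₁ : f₁ ≠ 0) (h : ∀ z, f₁ z * f₂ z = f₃ z * f₄ z) :
    (∃ c : ℝ, f₃ = c • f₁) ∨ ∃ c : ℝ, f₄ = c • f₁ ∧ f₂ = c • f₃ := by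
  have key : f₃ ∘ₗ (LinearMap.ker f₁).subtype = 0 ∨ f₄ ∘ₗ (LinearMap.ker f₁).subtype = 0 := by
    apply eq_zero_or_of_mul_eq_zero
    rintro ⟨z, hz⟩
    have := h z
    rw [LinearMap.mem_ker.1 hz] at this
    simpa using this.symm
  rcases key with h3 | h4
  · left
    exact exists_eq_smul_of_ker_le _ _ fun z hz => DFunLike.congr_fun h3 ⟨z, hz⟩
  · right
    obtain ⟨c, hc⟩ := exists_eq_smul_of_ker_le f₁ f₄ fun z hz => DFunLike.congr_fun h4 ⟨z, hz⟩
    refine ⟨c, hc, ?_⟩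
    have := eq_zero_or_of_mul_eq_zero f₁ (f₂ - c • f₃) fun z => by
      have := h z
      rw [hc] at this
      simp only [LinearMap.smul_apply, smul_eq_mul, LinearMap.sub_apply] at this ⊢
      linarith
    exact sub_eq_zero.1 (this.resolve_left h₁)

/-- A faithful irreducible orthogonal representation of a group generated by reflections, together
with a vector `v` whose orbit spans a cone on which the form is nonpositive. -/
structure ReflectionRep {W E S : Type*} [Group W] [AddCommGroup E] [Module ℝ E]
    (b : LinearMap.BilinForm ℝ E) (ρ : Representation ℝ W E) (s : S → W) (α : S → E) (v : E) :
    Prop where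
  symm : ∀ x y, b x y = b y x
  nondegenerate : ∀ x, (∀ y, b x y = 0) → x = 0
  invariant : ∀ w x y, b (ρ w x) (ρ w y) = b x y
  faithful : ∀ w, (∀ x, ρ w x = x) → w = 1
  norm_one : ∀ i, b (α i) (α i) = 1
  abs_le_one : ∀ i j, |b (α i) (α j)| ≤ 1
  reflection : ∀ i x, ρ (s i) x = x - (2 * b x (α i)) • α i
  irreducible : ∀ U : Submodule ℝ E, (∀ i, ∀ x ∈ U, ρ (s i) x ∈ U) → U = ⊥ ∨ U = ⊤
  span_eq_top : Submodule.span ℝ (Set.range α) = ⊤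
  vector_ne_zero : v ≠ 0
  vector_nonpos : ∀ w, b v (ρ w v) ≤ 0
  unbounded : ∀ C, ∃ w, b v (ρ w v) < -C

namespace ReflectionRep

variable {W E S : Type*} [Group W] [AddCommGroup E] [Module ℝ E]
  {b : LinearMap.BilinForm ℝ E} {ρ : Representation ℝ W E} {s : S → W} {α : S → E} {v : E}

theorem apply_inv_apply (ρ : Representation ℝ W E) (w : W) (x : E) : ρ w (ρ w⁻¹ x) = x := by
  simp [← Module.End.mul_apply, ← map_mul]

theorem inv_apply_apply (ρ : Representation ℝ W E) (w : W) (x : E) : ρ w⁻¹ (ρ w x) = x := by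
  simp [← Module.End.mul_apply, ← map_mul]

theorem mul_apply (ρ : Representation ℝ W E) (w w' : W) (x : E) : ρ (w * w') x = ρ w (ρ w' x) := by
  simp

/-- The dual cone of the orbit of `v`. -/
def InCone (b : LinearMap.BilinForm ℝ E) (ρ : Representation ℝ W E) (v z : E) : Prop :=
  ∀ w, b z (ρ w v) ≤ 0

variable (hR : ReflectionRep b ρ s α v)
include hR

theorem apply_left (w : W) (x y : E) : b (ρ w x) y = b x (ρ w⁻¹ y) := by
  rw [← hR.invariant w x, apply_inv_apply]

theorem apply_right (w : W) (x y : E) : b x (ρ w y) = b (ρ w⁻¹ x) y := by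
  rw [hR.apply_left, inv_inv]

theorem ext_form {x y : E} (h : ∀ z, b z x = b z y) : x = y := by
  refine sub_eq_zero.1 (hR.nondegenerate _ fun z => ?_)
  rw [hR.symm, map_sub, h, sub_self]

theorem inCone_apply {z : E} (hz : InCone b ρ v z) (w : W) : InCone b ρ v (ρ w z) := by
  intro w'
  rw [hR.apply_left, ← mul_apply]
  exact hz _

omit hR in
theorem inCone_add {x y : E} (hx : InCone b ρ v x) (hy : InCone b ρ v y) :
    InCone b ρ v (x + y) := by
  intro w
  have h1 := hx w
  have h2 := hy w
  simp only [map_add, LinearMap.add_apply]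
  linarith

theorem inCone_vector : InCone b ρ v v := hR.vector_nonpos

theorem span_orbit_eq_top {z : E} (hz : z ≠ 0) :
    Submodule.span ℝ (Set.range fun w => ρ w z) = ⊤ := by
  refine (hR.irreducible _ fun i x hx => ?_).resolve_left fun h => hz ?_
  · induction hx using Submodule.span_induction with
    | mem x hx =>
      obtain ⟨w, rfl⟩ := hx
      exact Submodule.subset_span ⟨s i * w, by simp⟩
    | zero => simp
    | add x y _ _ hx hy => rw [map_add]; exact add_mem hx hy
    | smul c x _ hx => rw [map_smul]; exact Submodule.smul_mem _ _ hx
  · rw [Submodule.span_eq_bot] at h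
    exact h z ⟨1, by simp⟩

theorem exists_form_orbit_ne_zero {z x : E} (hz : z ≠ 0) (hx : x ≠ 0) :
    ∃ w, b x (ρ w z) ≠ 0 := by
  by_contra! h
  refine hx (hR.nondegenerate x fun y => ?_)
  have hy : y ∈ Submodule.span ℝ (Set.range fun w => ρ w z) := by
    rw [hR.span_orbit_eq_top hz]; trivial
  induction hy using Submodule.span_induction with
  | mem x hx =>
    obtain ⟨w, rfl⟩ := hx
    exact h w
  | zero => simp
  | add x y _ _ hx hy => rw [map_add, hx, hy, add_zero]
  | smul c x _ hx => rw [map_smul, hx, smul_zero]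

theorem inCone_pointed {z : E} (hz : InCone b ρ v z) (hz' : InCone b ρ v (-z)) : z = 0 := by
  by_contra hne
  obtain ⟨w, hw⟩ := hR.exists_form_orbit_ne_zero hR.vector_ne_zero hne
  have h1 := hz w
  have h2 := hz' w
  simp only [map_neg, LinearMap.neg_apply] at h2
  exact hw (by linarith)

theorem eq_zero_of_add_eq_zero {x y : E} (hx : InCone b ρ v x) (hy : InCone b ρ v y)
    (h : x + y = 0) : x = 0 :=
  hR.inCone_pointed hx (by rwa [neg_eq_of_add_eq_zero_right h])

/-- `g` acts as a hyperbolic isometry of a plane spanned by the isotropic eigenvectors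
`q` and `p`, and trivially on the orthogonal complement of that plane. -/
structure IsHyperbolic (b : LinearMap.BilinForm ℝ E) (ρ : Representation ℝ W E)
    (g : W) (c : ℝ) (q p : E) : Prop where
  one_lt : 1 < c
  apply_fst : ρ g q = c • q
  apply_snd : ρ g p = c⁻¹ • p
  fst_self : b q q = 0
  snd_self : b p p = 0
  form_ne_zero : b q p ≠ 0
  apply_orthogonal : ∀ m, b m q = 0 → b m p = 0 → ρ g m = m

omit hR in
theorem IsHyperbolic.pow {g : W} {c : ℝ} {q p : E} (h : IsHyperbolic b ρ g c q p) {n : ℕ}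
    (hn : n ≠ 0) : IsHyperbolic b ρ (g ^ n) (c ^ n) q p where
  one_lt := one_lt_pow₀ h.one_lt hn
  apply_fst := by
    clear hn
    induction n with
    | zero => simp
    | succ n ih => rw [pow_succ', mul_apply, ih, map_smul, h.apply_fst, smul_smul, pow_succ]
  apply_snd := by
    clear hn
    induction n with
    | zero => simp
    | succ n ih =>
      rw [pow_succ', mul_apply, ih, map_smul, h.apply_snd, smul_smul, ← mul_inv, pow_succ]
  fst_self := h.fst_self
  snd_self := h.snd_self
  form_ne_zero := h.form_ne_zero
  apply_orthogonal m h1 h2 := by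
    clear hn
    induction n with
    | zero => simp
    | succ n ih => rw [pow_succ', mul_apply, ih, h.apply_orthogonal m h1 h2]

theorem IsHyperbolic.inv {g : W} {c : ℝ} {q p : E} (h : IsHyperbolic b ρ g c q p) :
    IsHyperbolic b ρ g⁻¹ c p q where
  one_lt := h.one_lt
  apply_fst := by
    have hc : c ≠ 0 := by linarith [h.one_lt]
    calc ρ g⁻¹ p = ρ g⁻¹ (c • c⁻¹ • p) := by rw [smul_smul, mul_inv_cancel₀ hc, one_smul]
      _ = c • p := by rw [map_smul, ← h.apply_snd, inv_apply_apply]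
  apply_snd := by
    have hc : c ≠ 0 := by linarith [h.one_lt]
    calc ρ g⁻¹ q = ρ g⁻¹ (c⁻¹ • c • q) := by rw [smul_smul, inv_mul_cancel₀ hc, one_smul]
      _ = c⁻¹ • q := by rw [map_smul, ← h.apply_fst, inv_apply_apply]
  fst_self := h.snd_self
  snd_self := h.fst_self
  form_ne_zero := by rw [hR.symm]; exact h.form_ne_zero
  apply_orthogonal m h1 h2 := by
    conv_lhs => rw [← h.apply_orthogonal m h2 h1]
    exact inv_apply_apply ρ g m

theorem IsHyperbolic.exists_decomp {g : W} {c : ℝ} {q p : E} (h : IsHyperbolic b ρ g c q p)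
    (z : E) : ∃ m, b m q = 0 ∧ b m p = 0 ∧
      z = (b z p / b q p) • q + m + (b z q / b q p) • p := by
  have h0 := h.form_ne_zero
  refine ⟨z - (b z p / b q p) • q - (b z q / b q p) • p, ?_, ?_, by abel⟩
  · simp [h.fst_self, hR.symm p q, h0]
  · simp [h.snd_self, h0]

omit hR in
theorem IsHyperbolic.pow_apply {g : W} {c : ℝ} {q p : E} (h : IsHyperbolic b ρ g c q p)
    {m : E} (hq : b m q = 0) (hp : b m p = 0) (x y : ℝ) (n : ℕ) :
    ρ (g ^ n) (x • q + m + y • p) = (c ^ n) • x • q + m + (c ^ n)⁻¹ • y • p := by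
  rcases eq_or_ne n 0 with rfl | hn
  · simp
  have := h.pow hn
  rw [map_add, map_add, map_smul, map_smul, this.apply_fst, this.apply_snd,
    this.apply_orthogonal m hq hp, smul_comm x, smul_comm y]

/-- The leading term of the forward orbit of a vector of the cone is in the cone. -/
theorem IsHyperbolic.inCone_fst {g : W} {c : ℝ} {q p : E} (h : IsHyperbolic b ρ g c q p)
    {z : E} (hz : InCone b ρ v z) : InCone b ρ v (b z p • b q p • q) := by
  obtain ⟨m, hq, hp, hm⟩ := IsHyperbolic.exists_decomp hR h z
  intro w
  have h0 := h.form_ne_zero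
  have key : b ((b z p / b q p) • q) (ρ w v) ≤ 0 := by
    refine leading_nonpos_of_pow h.one_lt (y := b m (ρ w v))
      (z := b ((b z q / b q p) • p) (ρ w v)) fun n => ?_
    have hc : 0 < c ^ n := pow_pos (by linarith [h.one_lt]) n
    have h1 := hR.inCone_apply hz (g ^ n) w
    rw [hm, h.pow_apply hq hp] at h1
    have h2 := mul_nonpos_of_nonneg_of_nonpos hc.le h1
    refine le_of_eq_of_le ?_ h2
    simp only [map_add, LinearMap.add_apply, map_smul, LinearMap.smul_apply, smul_eq_mul]
    field_simp
  have h3 := mul_nonpos_of_nonneg_of_nonpos (sq_nonneg (b q p)) key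
  refine le_of_eq_of_le ?_ h3
  simp only [map_smul, LinearMap.smul_apply, smul_eq_mul]
  field_simp

/-- If a vector of the cone has no component along the attracting direction, its component
orthogonal to the hyperbolic plane lies in the cone. -/
theorem IsHyperbolic.inCone_orthogonal {g : W} {c : ℝ} {q p : E} (h : IsHyperbolic b ρ g c q p)
    {z : E} (hz : InCone b ρ v z) (hzp : b z p = 0) :
    InCone b ρ v (z - (b z q / b q p) • p) := by
  obtain ⟨m, hq, hp, hm⟩ := IsHyperbolic.exists_decomp hR h z
  rw [hzp, zero_div, zero_smul, zero_add] at hm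
  have hm' : z - (b z q / b q p) • p = m := by
    conv_lhs => enter [1]; rw [hm]
    abel
  rw [hm']
  intro w
  refine leading_nonpos_of_pow h.one_lt (y := b ((b z q / b q p) • p) (ρ w v)) (z := 0) fun n => ?_
  have hc : 0 < c ^ n := pow_pos (by linarith [h.one_lt]) n
  have h1 := hR.inCone_apply hz (g ^ n) w
  have h4 := h.pow_apply hq hp 0 (b z q / b q p) n
  rw [zero_smul, smul_zero, zero_add, ← hm] at h4
  rw [h4] at h1
  have h2 := mul_nonpos_of_nonneg_of_nonpos (sq_nonneg (c ^ n)) h1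
  refine le_of_eq_of_le ?_ h2
  simp only [map_add, LinearMap.add_apply, map_smul, LinearMap.smul_apply, smul_eq_mul]
  field_simp
  ring

end ReflectionRep

namespace ReflectionRep

variable {W E S : Type*} [Group W] [AddCommGroup E] [Module ℝ E]
  {b : LinearMap.BilinForm ℝ E} {ρ : Representation ℝ W E} {s : S → W} {α : S → E} {v : E}

theorem exists_one_lt_abs [Fintype S] (hR : ReflectionRep b ρ s α v) :
    ∃ w i j, 1 < |b (ρ w (α i)) (α j)| := by
  by_contra! h
  have hv : v ∈ Submodule.span ℝ (Set.range α) := by rw [hR.span_eq_top]; trivial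
  obtain ⟨c, hc⟩ := (Submodule.mem_span_range_iff_exists_fun ℝ).1 hv
  obtain ⟨w, hw⟩ := hR.unbounded (∑ i, ∑ j, |c i| * |c j|)
  have key : b v (ρ w v) = ∑ i, ∑ j, c i * c j * b (ρ w (α i)) (α j) := by
    rw [← hc]
    simp only [map_sum, map_smul, LinearMap.sum_apply, LinearMap.smul_apply, smul_eq_mul,
      Finset.mul_sum]
    exact Finset.sum_congr rfl fun i _ => Finset.sum_congr rfl fun j _ => by
      rw [hR.symm (α j)]; ring
  have h2 : |b v (ρ w v)| ≤ ∑ i, ∑ j, |c i| * |c j| := by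
    rw [key]
    refine (Finset.abs_sum_le_sum_abs _ _).trans (Finset.sum_le_sum fun i _ => ?_)
    refine (Finset.abs_sum_le_sum_abs _ _).trans (Finset.sum_le_sum fun j _ => ?_)
    rw [abs_mul, abs_mul]
    exact mul_le_of_le_one_right (by positivity) (h w i j)
  linarith [neg_abs_le (b v (ρ w v))]

theorem isHyperbolic_mul (hR : ReflectionRep b ρ s α v) {r r' : W} {x y : E} {μ : ℝ}
    (hx : b x x = 1) (hy : b y y = 1) (hr : ∀ z, ρ r z = z - (2 * b z x) • x)
    (hr' : ∀ z, ρ r' z = z - (2 * b z y) • y) (hμ : 1 < μ) (hxy : -2 * b x y = μ + μ⁻¹) :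
    IsHyperbolic b ρ (r * r') (μ ^ 2) (x + μ⁻¹ • y) (x + μ • y) := by
  have hμ0 : μ ≠ 0 := by linarith
  have hk : b x y = -(μ + μ⁻¹) / 2 := by linarith
  have hk' : b y x = -(μ + μ⁻¹) / 2 := by rw [hR.symm, hk]
  have e1 : ρ r' (x + μ⁻¹ • y) = x + μ • y := by
    rw [hr']
    simp only [map_add, map_smul, LinearMap.add_apply, LinearMap.smul_apply, smul_eq_mul, hk, hy]
    module
  have e2 : ρ r' (x + μ • y) = x + μ⁻¹ • y := by
    rw [hr']
    simp only [map_add, map_smul, LinearMap.add_apply, LinearMap.smul_apply, smul_eq_mul, hk, hy]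
    module
  have e3 : ρ r (x + μ • y) = μ ^ 2 • (x + μ⁻¹ • y) := by
    rw [hr]
    simp only [map_add, map_smul, LinearMap.add_apply, LinearMap.smul_apply, smul_eq_mul, hk', hx]
    match_scalars <;> field_simp
    ring
  have e4 : ρ r (x + μ⁻¹ • y) = (μ ^ 2)⁻¹ • (x + μ • y) := by
    rw [hr]
    simp only [map_add, map_smul, LinearMap.add_apply, LinearMap.smul_apply, smul_eq_mul, hk', hx]
    match_scalars <;> field_simp
    ring
  refine ⟨one_lt_pow₀ hμ two_ne_zero, by rw [mul_apply, e1, e3], by rw [mul_apply, e2, e4],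
    ?_, ?_, ?_, ?_⟩
  · simp only [map_add, map_smul, LinearMap.add_apply, LinearMap.smul_apply, smul_eq_mul, hk, hk',
      hx, hy]
    field_simp
    ring
  · simp only [map_add, map_smul, LinearMap.add_apply, LinearMap.smul_apply, smul_eq_mul, hk, hk',
      hx, hy]
    field_simp
    ring
  · simp only [map_add, map_smul, LinearMap.add_apply, LinearMap.smul_apply, smul_eq_mul, hk, hk',
      hx, hy]
    have h1 : μ ^ 2 - 1 ≠ 0 := by nlinarith
    refine ne_of_eq_of_ne (b := -(μ ^ 2 - 1) ^ 2 / (2 * μ ^ 2)) ?_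
      (div_ne_zero (neg_ne_zero.2 (pow_ne_zero _ h1)) (by positivity))
    field_simp
    ring
  · intro m h1 h2
    simp only [map_add, map_smul, smul_eq_mul] at h1 h2
    have h3 : (μ - μ⁻¹) * b m y = 0 := by linarith
    have h4 : μ - μ⁻¹ ≠ 0 := by
      have := inv_lt_one_of_one_lt₀ hμ
      exact ne_of_gt (by linarith)
    have h5 : b m y = 0 := (mul_eq_zero.1 h3).resolve_left h4
    have h6 : b m x = 0 := by simpa [h5] using h1
    rw [mul_apply, hr', hr]
    simp [h5, h6]

theorem exists_isHyperbolic [Fintype S] (hR : ReflectionRep b ρ s α v) :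
    ∃ g c q p, IsHyperbolic b ρ g c q p := by
  obtain ⟨w, i, j, hij⟩ := hR.exists_one_lt_abs
  have key : ∃ y, b y y = 1 ∧ b (ρ w (α i)) y < -1 ∧ ∀ z, ρ (s j) z = z - (2 * b z y) • y := by
    rcases lt_abs.1 hij with h | h
    · exact ⟨-α j, by simp [hR.norm_one], by simpa using h, fun z => by
        rw [hR.reflection]; simp⟩
    · exact ⟨α j, hR.norm_one j, by linarith, hR.reflection j⟩
  obtain ⟨y, hy, hxy, hr'⟩ := key
  set x := ρ w (α i) with hx
  have hr : ∀ z, ρ (w * s i * w⁻¹) z = z - (2 * b z x) • x := by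
    intro z
    rw [mul_apply, mul_apply, hR.reflection, map_sub, map_smul, apply_inv_apply, hR.apply_left,
      inv_inv]
  set k := b x y
  have hd : 0 ≤ k ^ 2 - 1 := by nlinarith
  have hs := Real.sq_sqrt hd
  have hs0 := Real.sqrt_nonneg (k ^ 2 - 1)
  set d := √(k ^ 2 - 1)
  have hμ : 1 < -k + d := by linarith
  refine ⟨_, _, _, _, hR.isHyperbolic_mul (by rw [hx, hR.invariant, hR.norm_one]) hy hr hr' hμ ?_⟩
  have : (-k + d)⁻¹ = -k - d := by
    apply inv_eq_of_mul_eq_one_left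
    nlinarith
  rw [this]
  change -2 * k = _
  ring

/-- Every finite-index subgroup contains a hyperbolic element whose axes lie in the cone. -/
theorem exists_isHyperbolic_mem [Fintype S] (hR : ReflectionRep b ρ s α v) (Γ : Subgroup W)
    [Γ.FiniteIndex] : ∃ g ∈ Γ, ∃ c q p, IsHyperbolic b ρ g c q p ∧ InCone b ρ v q ∧
      InCone b ρ v p := by
  obtain ⟨g, c, q, p, h⟩ := hR.exists_isHyperbolic
  obtain ⟨n, hn, -, hg⟩ := Subgroup.exists_pow_mem_of_index_ne_zero
    (Subgroup.FiniteIndex.index_ne_zero (H := Γ)) g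
  have key : ∀ {g c q p}, IsHyperbolic b ρ g c q p → ∃ t : ℝ, t ≠ 0 ∧ InCone b ρ v (t • q) := by
    intro g c q p h
    have hp : p ≠ 0 := by
      rintro rfl
      exact h.form_ne_zero (by simp)
    obtain ⟨w, hw⟩ := hR.exists_form_orbit_ne_zero hR.vector_ne_zero hp
    have := IsHyperbolic.inCone_fst hR h (hR.inCone_apply hR.inCone_vector w)
    rw [smul_smul] at this
    exact ⟨_, mul_ne_zero (by rwa [hR.symm]) h.form_ne_zero, this⟩
  obtain ⟨t, ht, hq⟩ := key h
  obtain ⟨t', ht', hp⟩ := key (IsHyperbolic.inv hR h)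
  have hN := h.pow hn.ne'
  refine ⟨g ^ n, hg, c ^ n, t • q, t' • p, ⟨hN.one_lt, ?_, ?_, ?_, ?_, ?_, ?_⟩, hq, hp⟩
  · rw [map_smul, hN.apply_fst, smul_comm]
  · rw [map_smul, hN.apply_snd, smul_comm]
  · simp [h.fst_self]
  · simp [h.snd_self]
  · simp [h.form_ne_zero, ht, ht']
  · intro m h1 h2
    exact hN.apply_orthogonal m (by simpa [ht] using h1) (by simpa [ht'] using h2)

end ReflectionRep

namespace ReflectionRep

variable {W E S : Type*} [Group W] [AddCommGroup E] [Module ℝ E]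
  {b : LinearMap.BilinForm ℝ E} {ρ : Representation ℝ W E} {s : S → W} {α : S → E} {v : E}

theorem IsHyperbolic.eq_smul_of_apply_eq_smul (hR : ReflectionRep b ρ s α v) {g : W} {c : ℝ}
    {q p x : E} (h : IsHyperbolic b ρ g c q p) {t : ℝ} (hx : ρ g x = t • x) (hxp : b x p ≠ 0) :
    ∃ a : ℝ, x = a • q := by
  obtain ⟨m, hq, hp, hm⟩ := IsHyperbolic.exists_decomp hR h x
  have hc := h.one_lt
  have hc0 : c ≠ 0 := by linarith
  have h1 : t = c := by
    have := hR.invariant g x p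
    rw [hx, h.apply_snd, map_smul, map_smul, LinearMap.smul_apply, smul_eq_mul, smul_eq_mul] at this
    field_simp at this
    linarith
  have h2 : b x q = 0 := by
    have := hR.invariant g x q
    rw [hx, h.apply_fst, map_smul, map_smul, LinearMap.smul_apply, smul_eq_mul, smul_eq_mul,
      h1] at this
    have h3 : (c * c - 1) * b x q = 0 := by linarith
    exact (mul_eq_zero.1 h3).resolve_left (by nlinarith)
  rw [h2, zero_div, zero_smul, add_zero] at hm
  refine ⟨b x p / b q p, ?_⟩
  have h3 : (c - 1) • m = 0 := by
    rw [hm, h1, map_add, map_smul, h.apply_fst, h.apply_orthogonal m hq hp] at hx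
    have h4 : c • m = m := by
      rw [smul_add, smul_comm c] at hx
      exact (add_left_cancel hx).symm
    rw [sub_smul, h4, one_smul, sub_self]
  rw [(smul_eq_zero.1 h3).resolve_left (by linarith), add_zero] at hm
  exact hm

theorem reflection_eq_self_of_form_eq_zero (hR : ReflectionRep b ρ s α v) {x : E} (i : S)
    (hx : b x x = 0) (h : b (ρ (s i) x) x = 0) : ρ (s i) x = x := by
  rw [hR.reflection] at h ⊢
  have h1 : b x (α i) = 0 := by
    simp only [map_sub, map_smul, LinearMap.sub_apply, LinearMap.smul_apply, hx, hR.symm (α i),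
      smul_eq_mul] at h
    nlinarith
  simp [h1]

/-- The span of a hyperbolic plane is a proper subspace. -/
theorem IsHyperbolic.span_ne_top (hR : ReflectionRep b ρ s α v) {g : W} {c : ℝ}
    {q p : E} (h : IsHyperbolic b ρ g c q p) : Submodule.span ℝ {q, p} ≠ ⊤ := by
  intro hP
  have h0 := h.form_ne_zero
  have hq0 : q ≠ 0 := by
    rintro rfl
    simp at h0
  have hdec : ∀ x, x = (b x p / b q p) • q + (b x q / b q p) • p := by
    intro x
    obtain ⟨m, hq, hp, hm⟩ := IsHyperbolic.exists_decomp hR h x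
    have : m = 0 := by
      refine hR.nondegenerate m fun y => ?_
      have hy : y ∈ Submodule.span ℝ {q, p} := by rw [hP]; trivial
      obtain ⟨a, d, rfl⟩ := Submodule.mem_span_pair.1 hy
      simp [hq, hp]
    rwa [this, add_zero] at hm
  have hS : Nonempty S := by
    by_contra hS
    rw [not_nonempty_iff] at hS
    have := hR.span_eq_top
    rw [Set.range_eq_empty, Submodule.span_empty] at this
    have hq : q ∈ (⊥ : Submodule ℝ E) := by rw [this]; trivial
    exact hq0 hq
  obtain ⟨i⟩ := hS
  have key : ∀ j, α j ∈ Submodule.span ℝ {α i} := by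
    intro j
    have form : ∀ x y, b x y = (b x p * b y q + b x q * b y p) / b q p := by
      intro x y
      conv_lhs => rw [hdec x]
      simp only [map_add, map_smul, LinearMap.add_apply, LinearMap.smul_apply, smul_eq_mul]
      rw [hR.symm q y, hR.symm p y]
      ring
    have hi := hR.norm_one i
    have hj := hR.norm_one j
    have hij := hR.abs_le_one i j
    rw [← sq_le_one_iff_abs_le_one] at hij
    rw [form] at hi hj hij
    have hai : b (α i) p ≠ 0 := by
      intro h
      simp [h] at hi
    rw [div_pow, div_le_one (by positivity)] at hij
    rw [div_eq_one_iff_eq h0] at hi hj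
    have e : b (α i) p * b (α j) q - b (α i) q * b (α j) p = 0 := by
      have : b q p ^ 2 = (b (α i) p * b (α i) q + b (α i) q * b (α i) p) *
        (b (α j) p * b (α j) q + b (α j) q * b (α j) p) := by rw [hi, hj, sq]
      rw [← sq_eq_zero_iff]
      nlinarith [sq_nonneg (b (α i) p * b (α j) q - b (α i) q * b (α j) p)]
    refine Submodule.mem_span_singleton.2 ⟨b (α j) p / b (α i) p, ?_⟩
    calc (b (α j) p / b (α i) p) • α i = (b (α j) p / b (α i) p) •
          ((b (α i) p / b q p) • q + (b (α i) q / b q p) • p) := by rw [← hdec]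
      _ = (b (α j) p / b q p) • q + (b (α j) q / b q p) • p := by
        match_scalars <;> field_simp
        linarith
      _ = α j := (hdec _).symm
  have hq : q ∈ Submodule.span ℝ {α i} := by
    have : Submodule.span ℝ (Set.range α) ≤ Submodule.span ℝ {α i} := by
      rw [Submodule.span_le]
      rintro _ ⟨j, rfl⟩
      exact key j
    exact this (by rw [hR.span_eq_top]; trivial)
  obtain ⟨t, rfl⟩ := Submodule.mem_span_singleton.1 hq
  have := h.fst_self
  simp only [map_smul, LinearMap.smul_apply, hR.norm_one, smul_eq_mul, mul_one] at this
  exact hq0 (by simp [mul_self_eq_zero.1 this])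

/-- The representation stays irreducible on restriction to a finite-index subgroup. -/
theorem eq_bot_or_eq_top [Fintype S] [FiniteDimensional ℝ E] (hR : ReflectionRep b ρ s α v)
    (Γ : Subgroup W) [Γ.FiniteIndex] (U : Submodule ℝ E) (hU : ∀ γ ∈ Γ, ∀ x ∈ U, ρ γ x ∈ U) :
    U = ⊥ ∨ U = ⊤ := by
  by_contra! hne
  let H := Γ.normalCore
  let P : Set (Submodule ℝ E) := {V | V ≠ ⊥ ∧ V ≤ U ∧ ∀ γ ∈ H, ∀ x ∈ V, ρ γ x ∈ V}
  have hP : P.Nonempty := ⟨U, hne.1, le_rfl, fun γ hγ => hU γ (Γ.normalCore_le hγ)⟩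
  obtain ⟨V, ⟨hV0, hVU, hV⟩, hmin⟩ := WellFounded.has_min wellFounded_lt P hP
  have hline : ∃ i, ∀ u ∈ V, b u (α i) = 0 → u = 0 := by
    by_contra! hcon
    refine (hR.irreducible V fun i => ?_).elim hV0 fun h => hne.2 (top_le_iff.1 (h ▸ hVU))
    obtain ⟨u, hu, hui, hu0⟩ := hcon i
    have hmem : V ⊓ V.comap (ρ (s i)) ∈ P := by
      refine ⟨?_, inf_le_left.trans hVU, fun γ hγ x hx => ⟨hV γ hγ x hx.1, ?_⟩⟩
      · refine (Submodule.ne_bot_iff _).2 ⟨u, ⟨hu, ?_⟩, hu0⟩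
        rw [SetLike.mem_coe, Submodule.mem_comap, hR.reflection, hui]
        simpa using hu
      · have h1 := hV _ (Γ.normalCore_normal.conj_mem γ hγ (s i)) _ hx.2
        rw [← mul_apply] at h1
        rw [SetLike.mem_coe, Submodule.mem_comap, ← mul_apply]
        convert h1 using 3
        group
    have h1 : V ⊓ V.comap (ρ (s i)) = V := by
      by_contra h
      exact hmin _ hmem (lt_of_le_of_ne inf_le_left h)
    intro x hx
    rw [← h1] at hx
    exact hx.2
  obtain ⟨i, hi⟩ := hline
  obtain ⟨u, hu, hu0⟩ := (Submodule.ne_bot_iff _).1 hV0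
  have hui : b u (α i) ≠ 0 := fun h => hu0 (hi u hu h)
  have heig : ∀ w, ∀ γ ∈ H, ∃ t : ℝ, ρ γ (ρ w u) = t • ρ w u := by
    intro w γ hγ
    have h1 := hV _ (by simpa using Γ.normalCore_normal.conj_mem γ hγ w⁻¹) u hu
    set y := ρ (w⁻¹ * γ * w) u with hy
    refine ⟨b y (α i) / b u (α i), ?_⟩
    have h2 := hi (y - (b y (α i) / b u (α i)) • u) (sub_mem h1 (Submodule.smul_mem _ _ hu))
      (by simp [hui])
    rw [← map_smul, ← sub_eq_zero.1 h2, hy, ← mul_apply, ← mul_apply]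
    congr 2
    group
  obtain ⟨g, hg, c, q, p, h, -, -⟩ := hR.exists_isHyperbolic_mem H
  have main : ∀ {g c q p}, g ∈ H → IsHyperbolic b ρ g c q p → ∀ i, ρ (s i) q ∈
      Submodule.span ℝ {q, p} := by
    intro g c q p hg h i
    have hp : p ≠ 0 := by
      rintro rfl
      exact h.form_ne_zero (by simp)
    obtain ⟨w, hw⟩ := hR.exists_form_orbit_ne_zero hu0 hp
    rw [hR.symm] at hw
    obtain ⟨t, ht⟩ := heig w g hg
    obtain ⟨a, ha⟩ := IsHyperbolic.eq_smul_of_apply_eq_smul hR h ht hw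
    have ha0 : a ≠ 0 := by
      rintro rfl
      rw [ha] at hw
      simp at hw
    have hsq : ∃ t : ℝ, ρ g (ρ (s i) q) = t • ρ (s i) q := by
      obtain ⟨t, ht⟩ := heig (s i * w) g hg
      rw [mul_apply (w := s i), ha, map_smul, map_smul, smul_comm] at ht
      exact ⟨t, smul_right_injective E ha0 ht⟩
    obtain ⟨t, ht⟩ := hsq
    by_cases h1 : b (ρ (s i) q) p = 0
    · by_cases h2 : b (ρ (s i) q) q = 0
      · rw [hR.reflection_eq_self_of_form_eq_zero i h.fst_self h2]
        exact Submodule.subset_span (by simp)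
      · have ht' : ρ g⁻¹ (ρ (s i) q) = t⁻¹ • ρ (s i) q := by
          have ht0 : t ≠ 0 := by
            rintro rfl
            have := hR.invariant g (ρ (s i) q) q
            rw [ht] at this
            simp at this
            exact h2 this.symm
          have h3 := congrArg (fun z => t⁻¹ • ρ g⁻¹ z) ht
          simp only [inv_apply_apply, map_smul] at h3
          rw [h3, smul_smul, inv_mul_cancel₀ ht0, one_smul]
        obtain ⟨d, hd⟩ := IsHyperbolic.eq_smul_of_apply_eq_smul hR
          (IsHyperbolic.inv hR h) ht' h2
        rw [hd]
        exact Submodule.smul_mem _ _ (Submodule.subset_span (by simp))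
    · obtain ⟨d, hd⟩ := IsHyperbolic.eq_smul_of_apply_eq_smul hR h ht h1
      rw [hd]
      exact Submodule.smul_mem _ _ (Submodule.subset_span (by simp))
  refine h.span_ne_top hR ((hR.irreducible _ fun i x hx => ?_).resolve_left fun hbot => ?_)
  · obtain ⟨a, d, rfl⟩ := Submodule.mem_span_pair.1 hx
    rw [map_add, map_smul, map_smul]
    refine add_mem (Submodule.smul_mem _ _ (main hg h i)) (Submodule.smul_mem _ _ ?_)
    rw [Set.pair_comm]
    exact main (H.inv_mem hg) (IsHyperbolic.inv hR h) i
  · rw [Submodule.span_eq_bot] at hbot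
    have := h.form_ne_zero
    rw [hbot q (by simp)] at this
    simp at this

end ReflectionRep

namespace ReflectionRep

variable {W E S : Type*} [Group W] [AddCommGroup E] [Module ℝ E]
  {b : LinearMap.BilinForm ℝ E} {ρ : Representation ℝ W E} {s : S → W} {α : S → E} {v : E}

theorem eq_of_pow_eq {c : ℝ} (hc : 1 < c) {a₀ a₁ a₂ a₃ a₄ b₀ b₁ b₂ b₃ b₄ : ℝ}
    (h : ∀ n : ℕ, a₄ * (c ^ n) ^ 4 + a₃ * (c ^ n) ^ 3 + a₂ * (c ^ n) ^ 2 + a₁ * c ^ n + a₀ =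
      b₄ * (c ^ n) ^ 4 + b₃ * (c ^ n) ^ 3 + b₂ * (c ^ n) ^ 2 + b₁ * c ^ n + b₀) :
    a₄ = b₄ ∧ a₃ = b₃ := by
  have := eq_zero_of_pow_roots hc (a₀ := a₀ - b₀) (a₁ := a₁ - b₁) (a₂ := a₂ - b₂)
    (a₃ := a₃ - b₃) (a₄ := a₄ - b₄) fun n => by linarith [h n]
  exact ⟨sub_eq_zero.1 this.1, sub_eq_zero.1 this.2⟩

theorem IsHyperbolic.leading_coeffs (hR : ReflectionRep b ρ s α v) {g : W} {c : ℝ}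
    {q p : E} (h : IsHyperbolic b ρ g c q p) {A : Subgroup W} (hA : ∀ a ∈ A, g⁻¹ * a * g ∈ A)
    {a β : W} (ha : a ∈ A) (hβ : ∀ a ∈ A, a * β = β * a) (z : E) :
    b (ρ a q) q * b z p ^ 2 = b (ρ a q) q * b (ρ β z) p ^ 2 ∧
    (b (ρ a q) q = 0 → b z p * b z (ρ a q + ρ a⁻¹ q - (b (ρ a q + ρ a⁻¹ q) p / b q p) • q) =
      b (ρ β z) p * b (ρ β z) (ρ a q + ρ a⁻¹ q - (b (ρ a q + ρ a⁻¹ q) p / b q p) • q)) := by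
  have h0 := h.form_ne_zero
  have hc : ∀ n : ℕ, c ^ n ≠ 0 := fun n => (pow_pos (by linarith [h.one_lt]) n).ne'
  have hAn : ∀ n : ℕ, (g ^ n)⁻¹ * a * g ^ n ∈ A := by
    intro n
    induction n with
    | zero => simpa using ha
    | succ n ih =>
      convert hA _ ih using 1
      rw [pow_succ]
      group
  have hinv : ∀ n : ℕ, b (ρ a (ρ (g ^ n) (ρ β z))) (ρ (g ^ n) (ρ β z)) =
      b (ρ a (ρ (g ^ n) z)) (ρ (g ^ n) z) := by
    intro n
    have key : ∀ x, b (ρ a (ρ (g ^ n) x)) (ρ (g ^ n) x) =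
        b (ρ ((g ^ n)⁻¹ * a * g ^ n) x) x := by
      intro x
      rw [hR.apply_right, mul_apply, mul_apply]
    rw [key, key, ← mul_apply, hβ _ (hAn n), mul_apply, hR.invariant]
  have hexp : ∀ (n : ℕ) {x m y}, b m q = 0 → b m p = 0 →
      (c ^ n) ^ 2 * b (ρ a (ρ (g ^ n) (x • q + m + y • p))) (ρ (g ^ n) (x • q + m + y • p)) =
      (x ^ 2 * b (ρ a q) q) * (c ^ n) ^ 4 + (x * b m (ρ a q + ρ a⁻¹ q)) * (c ^ n) ^ 3 +
      (x * y * b (ρ a q) p + b (ρ a m) m + x * y * b (ρ a p) q) * (c ^ n) ^ 2 +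
      (y * b (ρ a m) p + y * b (ρ a p) m) * c ^ n + y ^ 2 * b (ρ a p) p := by
    intro n x m y hmq hmp
    have hcn := hc n
    rw [h.pow_apply hmq hmp]
    have e1 : b m (ρ a⁻¹ q) = b (ρ a m) q := by rw [hR.apply_left]
    simp only [map_add, LinearMap.add_apply, map_smul, LinearMap.smul_apply, smul_eq_mul, e1,
      hR.symm m (ρ a q)]
    field_simp
    ring
  obtain ⟨m, hmq, hmp, hm⟩ := IsHyperbolic.exists_decomp hR h z
  obtain ⟨m', hmq', hmp', hm'⟩ := IsHyperbolic.exists_decomp hR h (ρ β z)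
  have hpoly := fun n : ℕ => by
    have e1 := hexp n hmq hmp (x := b z p / b q p) (y := b z q / b q p)
    have e2 := hexp n hmq' hmp' (x := b (ρ β z) p / b q p) (y := b (ρ β z) q / b q p)
    rw [← hm] at e1
    rw [← hm', hinv, e1] at e2
    exact e2
  obtain ⟨h4, h3⟩ := eq_of_pow_eq h.one_lt hpoly
  constructor
  · field_simp at h4
    linarith
  · intro hB
    have e1 : b q (ρ a⁻¹ q) = b (ρ a q) q := by rw [hR.apply_left]
    have hqy : b q (ρ a q + ρ a⁻¹ q) = 0 := by rw [map_add, e1, hR.symm, hB, add_zero]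
    generalize ρ a q + ρ a⁻¹ q = y₀ at h3 hqy ⊢
    have key : ∀ {z m}, z = (b z p / b q p) • q + m + (b z q / b q p) • p →
        b m y₀ = b z (y₀ - (b y₀ p / b q p) • q) := by
      intro z m hm
      have e2 : m = z - (b z p / b q p) • q - (b z q / b q p) • p := by
        conv_rhs => enter [1, 1]; rw [hm]
        abel
      conv_lhs => rw [e2]
      simp only [map_sub, LinearMap.sub_apply, map_smul, LinearMap.smul_apply, smul_eq_mul, hqy,
        hR.symm y₀]
      ring
    rw [key hm, key hm'] at h3
    field_simp at h3
    linarith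

/-- If a hyperbolic element normalizes one of two commuting subgroups, then either that subgroup
fixes its attracting line or the squares of the other fix its repelling line. -/
theorem IsHyperbolic.apply_mem_span_or (hR : ReflectionRep b ρ s α v) {g : W} {c : ℝ}
    {q p : E} (h : IsHyperbolic b ρ g c q p) (hq : InCone b ρ v q) {A C : Subgroup W}
    (hA : ∀ a ∈ A, g⁻¹ * a * g ∈ A) (hAC : ∀ a ∈ A, ∀ β ∈ C, a * β = β * a) :
    (∀ a ∈ A, ρ a q ∈ Submodule.span ℝ {q}) ∨
      ∀ β ∈ C, ρ (β * β) p ∈ Submodule.span ℝ {p} := by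
  by_contra! hcon
  obtain ⟨⟨a, ha, haq⟩, β, hβ, hβp⟩ := hcon
  have h0 := h.form_ne_zero
  have hp0 : b.flip p ≠ 0 := by
    intro hp
    exact h0 (by simpa using DFunLike.congr_fun hp q)
  have hnot : ∀ t : ℝ, ρ β p ≠ t • p := by
    intro t ht
    refine hβp (Submodule.mem_span_singleton.2 ⟨t * t, ?_⟩)
    rw [mul_apply, ht, map_smul, ht, smul_smul]
  have hcoef := IsHyperbolic.leading_coeffs hR h hA ha
    (fun a ha => hAC a ha β⁻¹ (C.inv_mem hβ))
  have hmove : ∀ z x, b (ρ β⁻¹ z) x = b.flip (ρ β x) z := by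
    intro z x
    rw [hR.apply_left, inv_inv]
    rfl
  have hflip : ∀ {x y : E} {t : ℝ}, b.flip x = t • b.flip y → x = t • y := by
    intro x y t hxy
    refine hR.ext_form fun z => ?_
    simpa using DFunLike.congr_fun hxy z
  by_cases hB : b (ρ a q) q = 0
  · set y₀ := ρ a q + ρ a⁻¹ q with hy₀
    set q' := y₀ - (b y₀ p / b q p) • q with hq'
    by_cases hq0 : q' = 0
    · have hinv := IsHyperbolic.inv hR h
      have u1 := IsHyperbolic.inCone_orthogonal hR hinv (hR.inCone_apply hq a) hB
      have u2 := IsHyperbolic.inCone_orthogonal hR hinv (hR.inCone_apply hq a⁻¹)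
        (by rw [hR.apply_left, inv_inv, hR.symm, hB])
      have hsum := hR.eq_zero_of_add_eq_zero u1 u2 (by
        rw [← hq0, hq', hy₀, hR.symm p q]
        simp only [map_add, LinearMap.add_apply]
        module)
      exact haq (Submodule.mem_span_singleton.2 ⟨_, (sub_eq_zero.1 hsum).symm⟩)
    · have key : ∀ z, b.flip p z * b.flip q' z = b.flip (ρ β p) z * b.flip (ρ β q') z := by
        intro z
        rw [← hmove, ← hmove]
        exact (hcoef z).2 hB
      rcases eq_smul_of_mul_eq_mul hp0 key with ⟨t, ht⟩ | ⟨t, ht, ht'⟩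
      · exact hnot t (hflip ht)
      · have e1 := hflip ht
        have e2 := hflip ht'
        have ht0 : t ≠ 0 := by
          rintro rfl
          exact hq0 (by simpa using e2)
        refine hβp (Submodule.mem_span_singleton.2 ⟨1, ?_⟩)
        rw [e2, map_smul, ← mul_apply] at e1
        rw [one_smul]
        exact (smul_right_injective E ht0 e1).symm
  · have key : ∀ z, b.flip p z * b.flip p z = b.flip (ρ β p) z * b.flip (ρ β p) z := by
      intro z
      rw [← hmove]
      have := mul_left_cancel₀ hB (hcoef z).1
      rw [sq, sq] at this
      exact this
    rcases eq_smul_of_mul_eq_mul hp0 key with ⟨t, ht⟩ | ⟨t, ht, -⟩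
    · exact hnot t (hflip ht)
    · exact hnot t (hflip ht)

end ReflectionRep

namespace ReflectionRep

variable {W E S : Type*} [Group W] [AddCommGroup E] [Module ℝ E]
  {b : LinearMap.BilinForm ℝ E} {ρ : Representation ℝ W E} {s : S → W} {α : S → E} {v : E}

/-- A subgroup of exponent two normalized by a finite-index subgroup is trivial. -/
theorem eq_bot_of_mul_self_eq_one [Fintype S] [FiniteDimensional ℝ E]
    (hR : ReflectionRep b ρ s α v) (Γ N : Subgroup W) [Γ.FiniteIndex]
    (hΓN : ∀ γ ∈ Γ, ∀ a ∈ N, γ * a * γ⁻¹ ∈ N) (hN : ∀ a ∈ N, a * a = 1) : N = ⊥ := by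
  have hcomm : ∀ a ∈ N, ∀ a' ∈ N, a * a' = a' * a := by
    intro a ha a' ha'
    have h1 : a⁻¹ = a := inv_eq_of_mul_eq_one_left (hN a ha)
    have h2 : a'⁻¹ = a' := inv_eq_of_mul_eq_one_left (hN a' ha')
    have h3 : (a * a')⁻¹ = a * a' := inv_eq_of_mul_eq_one_left (hN _ (N.mul_mem ha ha'))
    rw [mul_inv_rev, h1, h2] at h3
    exact h3.symm
  let P : Set (Submodule ℝ E) :=
    {U | (∃ z ∈ U, z ≠ 0 ∧ InCone b ρ v z) ∧ ∀ a ∈ N, ∀ x ∈ U, ρ a x ∈ U}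
  have hP : P.Nonempty :=
    ⟨⊤, ⟨v, trivial, hR.vector_ne_zero, hR.inCone_vector⟩, fun _ _ _ _ => trivial⟩
  obtain ⟨U, ⟨⟨z, hzU, hz0, hz⟩, hU⟩, hmin⟩ := WellFounded.has_min wellFounded_lt P hP
  have hfix : ∀ a ∈ N, ∀ x ∈ U, ρ a x = x := by
    intro a ha
    have hmem : U ⊓ LinearMap.eqLocus (ρ a) LinearMap.id ∈ P := by
      refine ⟨⟨z + ρ a z, ⟨add_mem hzU (hU a ha z hzU), ?_⟩, fun h => hz0 ?_, ?_⟩, ?_⟩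
      · rw [SetLike.mem_coe, LinearMap.mem_eqLocus, map_add, ← mul_apply, hN a ha]
        simp [add_comm]
      · exact hR.eq_zero_of_add_eq_zero hz (hR.inCone_apply hz a) h
      · exact inCone_add hz (hR.inCone_apply hz a)
      · intro a' ha' x hx
        refine ⟨hU a' ha' x hx.1, ?_⟩
        have := hx.2
        rw [SetLike.mem_coe, LinearMap.mem_eqLocus, LinearMap.id_apply] at this ⊢
        rw [← mul_apply, hcomm a ha a' ha', mul_apply, this]
    have h1 : U ⊓ LinearMap.eqLocus (ρ a) LinearMap.id = U := by
      by_contra h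
      exact hmin _ hmem (lt_of_le_of_ne inf_le_left h)
    intro x hx
    rw [← h1] at hx
    exact hx.2
  let F : Submodule ℝ E := ⨅ a : N, LinearMap.eqLocus (ρ a) LinearMap.id
  have hF : ∀ x, x ∈ F ↔ ∀ a ∈ N, ρ a x = x := by
    intro x
    simp [F, LinearMap.mem_eqLocus]
  have htop : F = ⊤ := by
    refine (hR.eq_bot_or_eq_top Γ F fun γ hγ x hx => ?_).resolve_left fun h => hz0 ?_
    · rw [hF] at hx ⊢
      intro a ha
      have := hx _ (by simpa using hΓN γ⁻¹ (Γ.inv_mem hγ) a ha)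
      conv_rhs => rw [← this]
      rw [← mul_apply, ← mul_apply]
      congr 2
      group
    · have : z ∈ F := (hF z).2 fun a ha => hfix a ha z hzU
      rw [h] at this
      exact this
  refine (Subgroup.eq_bot_iff_forall N).2 fun a ha => hR.faithful a fun x => ?_
  have : x ∈ F := by rw [htop]; trivial
  exact (hF x).1 this a ha

/-- A subgroup normalized by a finite-index subgroup, whose squares have a common eigenvector in
the cone, is trivial. -/
theorem eq_bot_of_mul_self_apply_mem_span [Fintype S] [FiniteDimensional ℝ E]
    (hR : ReflectionRep b ρ s α v) (Γ N : Subgroup W) [Γ.FiniteIndex]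
    (hΓN : ∀ γ ∈ Γ, ∀ a ∈ N, γ * a * γ⁻¹ ∈ N) {z : E} (hz0 : z ≠ 0) (hz : InCone b ρ v z)
    (h : ∀ a ∈ N, ρ (a * a) z ∈ Submodule.span ℝ {z}) : N = ⊥ := by
  have h' : ∀ a : W, ∃ t : ℝ, a ∈ N → ρ (a * a) z = t • z := by
    intro a
    by_cases ha : a ∈ N
    · obtain ⟨t, ht⟩ := Submodule.mem_span_singleton.1 (h a ha)
      exact ⟨t, fun _ => ht.symm⟩
    · exact ⟨0, fun h => absurd h ha⟩
  choose χ hχ using h'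
  have hΓN' : ∀ γ ∈ Γ, ∀ a ∈ N, γ⁻¹ * a * γ ∈ N := fun γ hγ a ha => by
    simpa using hΓN γ⁻¹ (Γ.inv_mem hγ) a ha
  have horb : ∀ γ ∈ Γ, ∀ a ∈ N, ρ (a * a) (ρ γ z) = χ (γ⁻¹ * a * γ) • ρ γ z := by
    intro γ hγ a ha
    rw [← map_smul, ← hχ _ (hΓN' γ hγ a ha), ← mul_apply, ← mul_apply]
    congr 2
    group
  have hspan : Submodule.span ℝ (Set.range fun γ : Γ => ρ (γ : W) z) = ⊤ := by
    refine (hR.eq_bot_or_eq_top Γ _ fun γ hγ x hx => ?_).resolve_left fun hbot => hz0 ?_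
    · induction hx using Submodule.span_induction with
      | mem x hx =>
        obtain ⟨w, rfl⟩ := hx
        exact Submodule.subset_span ⟨⟨γ, hγ⟩ * w, by simp⟩
      | zero => simp
      | add x y _ _ hx hy => rw [map_add]; exact add_mem hx hy
      | smul c x _ hx => rw [map_smul]; exact Submodule.smul_mem _ _ hx
    · rw [Submodule.span_eq_bot] at hbot
      exact hbot z ⟨1, by simp⟩
  let X : Γ → N → ℝ := fun γ a => χ ((γ : W)⁻¹ * a * γ)
  have hfin : (Set.range X).Finite := by
    obtain ⟨T, hTsub, hTspan, hTind⟩ := exists_linearIndependent ℝ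
      (Set.range fun γ : Γ => ρ (γ : W) z)
    rw [hspan] at hTspan
    have : Finite T := hTind.finite
    choose f hf using fun t : T => hTsub t.2
    refine (Set.finite_range fun t => X (f t)).subset ?_
    rintro _ ⟨γ, rfl⟩
    have hmem : ρ (γ : W) z ∈ Submodule.span ℝ (Set.range ((↑) : T → E)) := by
      rw [Subtype.range_coe, hTspan]; trivial
    have := Fintype.ofFinite T
    obtain ⟨c, hc⟩ := (Submodule.mem_span_range_iff_exists_fun ℝ).1 hmem
    have hγ0 : ρ (γ : W) z ≠ 0 := by
      intro h0
      have := inv_apply_apply ρ (γ : W) z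
      rw [h0, map_zero] at this
      exact hz0 this.symm
    have hex : ∃ t, c t ≠ 0 := by
      by_contra! hc0
      exact hγ0 (by rw [← hc]; simp [hc0])
    obtain ⟨t, ht⟩ := hex
    refine ⟨t, ?_⟩
    ext a
    have e1 := horb γ γ.2 a a.2
    rw [← hc, map_sum, Finset.smul_sum] at e1
    have e2 : ∑ t : T, (c t * (X (f t) a - X γ a)) • (t : E) = 0 := by
      rw [← sub_eq_zero.2 e1, ← Finset.sum_sub_distrib]
      refine Finset.sum_congr rfl fun t _ => ?_
      have := horb (f t) (f t).2 a a.2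
      rw [show ρ (f t : W) z = t from hf t] at this
      rw [map_smul, this]
      simp only [X]
      module
    have e3 := Fintype.linearIndependent_iff.1 hTind _ e2 t
    exact sub_eq_zero.1 ((mul_eq_zero.1 e3).resolve_left ht)
  let K : Subgroup W :=
    { carrier := {γ | γ ∈ Γ ∧ ∀ a ∈ N, χ (γ⁻¹ * a * γ) = χ a}
      one_mem' := ⟨Γ.one_mem, by simp⟩
      mul_mem' := by
        rintro γ γ' ⟨hγ, h1⟩ ⟨hγ', h2⟩
        refine ⟨Γ.mul_mem hγ hγ', fun a ha => ?_⟩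
        rw [← h1 a ha, ← h2 _ (hΓN' γ hγ a ha)]
        congr 1
        group
      inv_mem' := by
        rintro γ ⟨hγ, h1⟩
        refine ⟨Γ.inv_mem hγ, fun a ha => ?_⟩
        rw [← h1 _ (hΓN' _ (Γ.inv_mem hγ) a ha)]
        congr 1
        group }
  have hKΓ : K ≤ Γ := fun γ hγ => hγ.1
  have hKfin : (K.subgroupOf Γ).FiniteIndex := by
    have hQ : ∀ γ γ' : Γ, X γ = X γ' → (γ : Γ ⧸ K.subgroupOf Γ) = γ' := by
      intro γ γ' hX
      rw [QuotientGroup.eq, Subgroup.mem_subgroupOf]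
      refine ⟨(γ⁻¹ * γ').2, fun a ha => ?_⟩
      have := congrFun hX ⟨γ * a * (γ : W)⁻¹, hΓN γ γ.2 a ha⟩
      simp only [X] at this
      convert this.symm using 2
      · simp; group
      · group
    rw [Subgroup.finiteIndex_iff_finite_quotient]
    have : Finite (Set.range X) := hfin
    refine Finite.of_injective (fun x : Γ ⧸ K.subgroupOf Γ => (⟨X x.out, _, rfl⟩ : Set.range X)) ?_
    intro x y hxy
    have := hQ _ _ (Subtype.mk_eq_mk.1 hxy)
    rwa [QuotientGroup.out_eq', QuotientGroup.out_eq'] at this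
  have hKfin' : K.FiniteIndex := by
    refine ⟨?_⟩
    rw [← Subgroup.relIndex_mul_index hKΓ]
    exact mul_ne_zero hKfin.index_ne_zero Subgroup.FiniteIndex.index_ne_zero
  let F : Submodule ℝ E := ⨅ a : N, LinearMap.eqLocus (ρ (a * a)) (χ a • LinearMap.id)
  have hF : ∀ x, x ∈ F ↔ ∀ a ∈ N, ρ (a * a) x = χ a • x := by
    intro x
    simp [F, LinearMap.mem_eqLocus]
  have hzF : z ∈ F := (hF z).2 fun a ha => hχ a ha
  have htop : F = ⊤ := by
    refine (hR.eq_bot_or_eq_top K F fun γ hγ x hx => ?_).resolve_left fun hb => hz0 ?_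
    · rw [hF] at hx ⊢
      intro a ha
      have := hx _ (hΓN' γ hγ.1 a ha)
      rw [hγ.2 a ha] at this
      rw [← map_smul, ← this, ← mul_apply, ← mul_apply]
      congr 2
      group
    · rw [hb] at hzF
      exact hzF
  have hscal : ∀ a ∈ N, ∀ x, ρ (a * a) x = χ a • x := fun a ha x =>
    (hF x).1 (by rw [htop]; trivial) a ha
  refine hR.eq_bot_of_mul_self_eq_one Γ N hΓN fun a ha => hR.faithful _ fun x => ?_
  rw [hscal a ha]
  have hsq : χ a * χ a = 1 := by
    obtain ⟨w, hw⟩ := hR.exists_form_orbit_ne_zero hz0 hz0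
    have := hR.invariant (a * a) z (ρ w z)
    rw [hscal a ha, hscal a ha] at this
    simp only [map_smul, LinearMap.smul_apply, smul_eq_mul] at this
    rw [← mul_assoc] at this
    exact mul_right_cancel₀ hw (by rw [this, one_mul])
  rcases mul_self_eq_one_iff.1 hsq with h1 | h1
  · rw [h1, one_smul]
  · refine absurd (hR.inCone_pointed hz ?_) hz0
    have := hR.inCone_apply hz (a * a)
    rwa [hscal a ha, h1, neg_one_smul] at this

/-- Of two commuting subgroups normalized by a finite-index subgroup, one is trivial. -/
theorem eq_bot_or_eq_bot_of_commute [Fintype S] [FiniteDimensional ℝ E]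
    (hR : ReflectionRep b ρ s α v) (Γ A C : Subgroup W) [Γ.FiniteIndex]
    (hA : ∀ γ ∈ Γ, ∀ a ∈ A, γ * a * γ⁻¹ ∈ A) (hC : ∀ γ ∈ Γ, ∀ a ∈ C, γ * a * γ⁻¹ ∈ C)
    (hAC : ∀ a ∈ A, ∀ β ∈ C, a * β = β * a) : A = ⊥ ∨ C = ⊥ := by
  obtain ⟨g, hg, c, q, p, h, hq, hp⟩ := hR.exists_isHyperbolic_mem Γ
  rcases IsHyperbolic.apply_mem_span_or hR h hq
    (fun a ha => by simpa using hA g⁻¹ (Γ.inv_mem hg) a ha) hAC with h1 | h1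
  · left
    refine hR.eq_bot_of_mul_self_apply_mem_span Γ A hA (z := q) ?_ hq
      fun a ha => h1 _ (A.mul_mem ha ha)
    rintro rfl
    exact h.form_ne_zero (by simp)
  · right
    refine hR.eq_bot_of_mul_self_apply_mem_span Γ C hC (z := p) ?_ hp h1
    rintro rfl
    exact h.form_ne_zero (by simp)

end ReflectionRep

section formEntry

variable {B : Type*} (M : CoxeterMatrix B)

theorem formEntry_comm (i j : B) : formEntry M i j = formEntry M j i := by
  rw [formEntry, formEntry, M.symmetric]

@[simp]
theorem formEntry_self (i : B) : formEntry M i i = 1 := by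
  simp [formEntry]

variable {M}

theorem two_le_of_ne {i j : B} (hij : i ≠ j) (h : M i j ≠ 0) : 2 ≤ M i j := by
  have := M.off_diagonal i j hij
  omega

theorem pi_div_mem_Ioc {m : ℕ} (hm : 2 ≤ m) : Real.pi / m ∈ Set.Ioc 0 (Real.pi / 2) := by
  have hm' : (2 : ℝ) ≤ m := by exact_mod_cast hm
  exact ⟨by positivity, div_le_div_of_nonneg_left Real.pi_pos.le two_pos hm'⟩

theorem formEntry_nonpos {i j : B} (hij : i ≠ j) : formEntry M i j ≤ 0 := by
  rw [formEntry]
  split_ifs with h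
  · norm_num
  · have := pi_div_mem_Ioc (two_le_of_ne hij h)
    exact neg_nonpos.2 (Real.cos_nonneg_of_mem_Icc ⟨by linarith [this.1, Real.pi_pos], this.2⟩)

theorem formEntry_neg {i j : B} (hij : i ≠ j) (h2 : M i j ≠ 2) : formEntry M i j < 0 := by
  rw [formEntry]
  split_ifs with h
  · norm_num
  · have h3 : 2 < M i j := lt_of_le_of_ne (two_le_of_ne hij h) h2.symm
    have h3' : (2 : ℝ) < M i j := by exact_mod_cast h3
    refine neg_neg_of_pos (Real.cos_pos_of_mem_Ioo ⟨?_, ?_⟩)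
    · have : 0 < Real.pi / M i j := by positivity
      linarith [Real.pi_pos]
    · exact div_lt_div_of_pos_left Real.pi_pos two_pos h3'

theorem abs_formEntry_le_one (i j : B) : |formEntry M i j| ≤ 1 := by
  rw [formEntry]
  split_ifs
  · simp
  · rw [abs_neg]
    exact Real.abs_cos_le_one _

theorem sin_pos_of_two_le {m : ℕ} (hm : 2 ≤ m) : 0 < Real.sin (Real.pi / m) := by
  have := pi_div_mem_Ioc hm
  exact Real.sin_pos_of_pos_of_lt_pi this.1 (by linarith [this.2, Real.pi_pos])

theorem formEntry_sq_lt_one {i j : B} (hij : i ≠ j) (h : M i j ≠ 0) : formEntry M i j ^ 2 < 1 := by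
  rw [formEntry, if_neg h]
  have := sin_pos_of_two_le (two_le_of_ne hij h)
  nlinarith [Real.sin_sq_add_cos_sq (Real.pi / M i j)]

/-- The coefficients of the roots of a dihedral subgroup. -/
theorem exists_dihedral_coeff {i j : B} (hij : i ≠ j) : ∃ u : ℤ → ℝ, u 0 = 0 ∧ u 1 = 1 ∧
    (∀ k, u (k + 2) = -2 * formEntry M i j * u (k + 1) - u k) ∧
    (∀ k : ℕ, (M i j ≠ 0 → k ≤ M i j) → 0 ≤ u k) ∧
    (M i j ≠ 0 → ∀ k, u (k + 2 * M i j) = u k) := by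
  by_cases h : M i j = 0
  · refine ⟨fun k => k, by simp, by simp, fun k => ?_, fun k _ => by simp, fun h' => absurd h h'⟩
    rw [formEntry, if_pos h]
    push_cast
    ring
  · have hm := two_le_of_ne hij h
    have hs := sin_pos_of_two_le hm
    have hm0 : (M i j : ℝ) ≠ 0 := by exact_mod_cast h
    rw [formEntry, if_neg h]
    set θ := Real.pi / (M i j : ℝ) with hθ
    refine ⟨fun k => Real.sin (k * θ) / Real.sin θ, by simp, by simp [hs.ne'], fun k => ?_,
      fun k hk => ?_, fun _ k => ?_⟩
    · push_cast
      have e1 : Real.sin ((k + 2) * θ) + Real.sin (k * θ) =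
          2 * Real.cos θ * Real.sin ((k + 1) * θ) := by
        rw [show ((k : ℝ) + 2) * θ = (k + 1) * θ + θ by ring,
          show (k : ℝ) * θ = (k + 1) * θ - θ by ring, Real.sin_add, Real.sin_sub]
        ring
      field_simp
      rw [mul_comm θ]
      linarith
    · refine div_nonneg (Real.sin_nonneg_of_nonneg_of_le_pi ?_ ?_) hs.le
      · have := (pi_div_mem_Ioc hm).1
        push_cast
        positivity
      · have hk' : (k : ℝ) ≤ M i j := by exact_mod_cast hk h
        rw [hθ]
        push_cast
        rw [mul_div_assoc', div_le_iff₀ (by positivity), mul_comm]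
        exact mul_le_mul_of_nonneg_left hk' Real.pi_pos.le
    · push_cast
      congr 1
      rw [show ((k : ℝ) + 2 * M i j) * θ = k * θ + 2 * Real.pi by rw [hθ]; field_simp]
      exact Real.sin_add_two_pi _

end formEntry

section Representation

variable {B E : Type*} [AddCommGroup E] [Module ℝ E] {M : CoxeterMatrix B}
  {b : LinearMap.BilinForm ℝ E} {α : B → E}

/-- The reflection in the hyperplane orthogonal to a vector of norm one. -/
def reflectionIn (b : LinearMap.BilinForm ℝ E) (x : E) : Module.End ℝ E :=
  LinearMap.id - (2 • b.flip x).smulRight x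

theorem reflectionIn_apply (b : LinearMap.BilinForm ℝ E) (x y : E) :
    reflectionIn b x y = y - (2 * b y x) • x := by
  simp [reflectionIn, two_mul]

theorem reflectionIn_mul_self {x : E} (hx : b x x = 1) :
    reflectionIn b x * reflectionIn b x = 1 := by
  ext y
  simp only [Module.End.mul_apply, reflectionIn_apply, map_sub, map_smul, hx,
    Module.End.one_apply]
  module

theorem form_reflectionIn (hb : ∀ x y, b x y = b y x) {x : E} (hx : b x x = 1) (y z : E) :
    b (reflectionIn b x y) (reflectionIn b x z) = b y z := by
  simp only [reflectionIn_apply, map_sub, map_smul, LinearMap.sub_apply, LinearMap.smul_apply, hx,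
    smul_eq_mul, hb x]
  ring

theorem reflectionIn_dihedral (hα : ∀ i j, b (α i) (α j) = formEntry M i j) {i j : B} {u : ℤ → ℝ}
    (hu : ∀ k, u (k + 2) = -2 * formEntry M i j * u (k + 1) - u k) (k : ℤ) :
    reflectionIn b (α j) (u (k + 1) • α i + u k • α j) = u (k + 1) • α i + u (k + 2) • α j := by
  rw [reflectionIn_apply, hu]
  simp only [map_add, map_smul, LinearMap.add_apply, LinearMap.smul_apply, hα, formEntry_self,
    smul_eq_mul]
  module

theorem isLiftable_reflectionIn (hα : ∀ i j, b (α i) (α j) = formEntry M i j) :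
    M.IsLiftable fun i => reflectionIn b (α i) := by
  intro i j
  rcases eq_or_ne i j with rfl | hij
  · rw [reflectionIn_mul_self (by rw [hα, formEntry_self]), one_pow]
  rcases eq_or_ne (M i j) 0 with h | h
  · rw [h, pow_zero]
  obtain ⟨u, hu0, hu1, hu, -, hper⟩ := exists_dihedral_coeff (M := M) hij
  have hu' : ∀ k, u (k + 2) = -2 * formEntry M j i * u (k + 1) - u k := by
    rwa [formEntry_comm]
  have hpow : ∀ (n : ℕ) (k : ℤ),
      ((reflectionIn b (α i) * reflectionIn b (α j)) ^ n) (u (k + 1) • α i + u k • α j) =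
        u (k + 1 + 2 * n) • α i + u (k + 2 * n) • α j := by
    intro n k
    induction n with
    | zero => simp
    | succ n ih =>
      have e1 := reflectionIn_dihedral hα hu (k + 2 * n)
      have e2 := reflectionIn_dihedral hα hu' (k + 2 * n + 1)
      rw [pow_succ', Module.End.mul_apply, ih, Module.End.mul_apply]
      rw [show k + 1 + 2 * (n : ℤ) = k + 2 * n + 1 by ring, e1, add_comm,
        show k + 2 * (n : ℤ) + 2 = k + 2 * n + 1 + 1 by ring, e2, add_comm]
      congr 3 <;> push_cast <;> ring
  have hi : ((reflectionIn b (α i) * reflectionIn b (α j)) ^ M i j) (α i) = α i := by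
    have := hpow (M i j) 0
    rw [hper h, hper h, hu0, zero_add, hu1] at this
    simpa using this
  have hj : ((reflectionIn b (α i) * reflectionIn b (α j)) ^ M i j) (α j) = α j := by
    have := hpow (M i j) (-1)
    have h1 : u (-1) = -1 := by
      have := hu (-1)
      norm_num [hu0, hu1] at this
      linarith
    rw [hper h, hper h, neg_add_cancel, hu0, h1] at this
    simpa using this
  have hortho : ∀ (n : ℕ) {z}, b z (α i) = 0 → b z (α j) = 0 →
      ((reflectionIn b (α i) * reflectionIn b (α j)) ^ n) z = z := by
    intro n z hzi hzj
    induction n with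
    | zero => simp
    | succ n ih =>
      rw [pow_succ', Module.End.mul_apply, ih, Module.End.mul_apply]
      simp [reflectionIn_apply, hzi, hzj]
  have hdet : 1 - formEntry M i j ^ 2 ≠ 0 := by
    have := formEntry_sq_lt_one hij h
    exact ne_of_gt (by linarith)
  ext z
  set x := (b z (α i) - formEntry M i j * b z (α j)) / (1 - formEntry M i j ^ 2)
  set y := (b z (α j) - formEntry M i j * b z (α i)) / (1 - formEntry M i j ^ 2)
  have hz : z = (z - x • α i - y • α j) + x • α i + y • α j := by abel
  have hz1 := hortho (M i j) (z := z - x • α i - y • α j)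
    (by
      simp only [map_sub, LinearMap.sub_apply, map_smul, LinearMap.smul_apply, hα, formEntry_self,
        formEntry_comm M j i, smul_eq_mul, x, y]
      field_simp
      ring)
    (by
      simp only [map_sub, LinearMap.sub_apply, map_smul, LinearMap.smul_apply, hα, formEntry_self,
        smul_eq_mul, x, y]
      field_simp
      ring)
  rw [Module.End.one_apply]
  conv_lhs => rw [hz]
  rw [map_add, map_add, map_smul, map_smul, hi, hj, hz1]
  exact hz.symm

end Representation

section Cone

variable {B E : Type*} [Fintype B] [AddCommGroup E] [Module ℝ E]

/-- A vector is a combination of the vectors `α i` with nonnegative coefficients. -/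
def IsNonneg (α : B → E) (x : E) : Prop :=
  ∃ c : B → ℝ, (∀ i, 0 ≤ c i) ∧ ∑ i, c i • α i = x

variable {α : B → E}

theorem IsNonneg.add {x y : E} (hx : IsNonneg α x) (hy : IsNonneg α y) : IsNonneg α (x + y) := by
  obtain ⟨c, hc, rfl⟩ := hx
  obtain ⟨d, hd, rfl⟩ := hy
  exact ⟨c + d, fun i => add_nonneg (hc i) (hd i), by simp [add_smul, Finset.sum_add_distrib]⟩

theorem IsNonneg.smul {x : E} (hx : IsNonneg α x) {t : ℝ} (ht : 0 ≤ t) : IsNonneg α (t • x) := by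
  obtain ⟨c, hc, rfl⟩ := hx
  exact ⟨t • c, fun i => mul_nonneg ht (hc i), by simp [Finset.smul_sum, mul_smul]⟩

theorem isNonneg_root (i : B) : IsNonneg α (α i) := by
  classical
  exact ⟨Pi.single i 1, fun j => by
    by_cases h : j = i <;> simp [h],
    by simp [Pi.single_apply]⟩

end Cone

section PositiveRoots

variable {B E W : Type*} [AddCommGroup E] [Module ℝ E] [Group W] {M : CoxeterMatrix B}
  {b : LinearMap.BilinForm ℝ E} {α : B → E}

/-- The reflection representation of a Coxeter group on a space with a root basis. -/
def geometricRep (cs : CoxeterSystem M W) (hα : ∀ i j, b (α i) (α j) = formEntry M i j) :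
    Representation ℝ W E :=
  cs.lift ⟨fun i => reflectionIn b (α i), isLiftable_reflectionIn hα⟩

theorem geometricRep_simple (cs : CoxeterSystem M W)
    (hα : ∀ i j, b (α i) (α j) = formEntry M i j) (i : B) :
    geometricRep cs hα (cs.simple i) = reflectionIn b (α i) :=
  cs.lift_apply_simple (isLiftable_reflectionIn hα) i

theorem geometricRep_alternatingWord (cs : CoxeterSystem M W)
    (hα : ∀ i j, b (α i) (α j) = formEntry M i j) {s t : B} {u : ℤ → ℝ} (hu0 : u 0 = 0)
    (hu1 : u 1 = 1) (hu : ∀ k, u (k + 2) = -2 * formEntry M s t * u (k + 1) - u k) (k : ℕ) :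
    geometricRep cs hα (cs.wordProd (CoxeterSystem.alternatingWord s t k)) (α s) =
      u (k + 1) • α (if Even k then s else t) + u k • α (if Even k then t else s) := by
  have hu' : ∀ k, u (k + 2) = -2 * formEntry M t s * u (k + 1) - u k := by
    rwa [formEntry_comm]
  induction k with
  | zero => simp [CoxeterSystem.alternatingWord, hu0, hu1]
  | succ k ih =>
    rw [CoxeterSystem.alternatingWord_succ', cs.wordProd_cons, map_mul, Module.End.mul_apply, ih,
      geometricRep_simple]
    push_cast
    rw [add_assoc (k : ℤ) 1 1]
    by_cases h : Even k
    · simp only [h, if_true, Nat.even_add_one, not_true, if_false]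
      rw [reflectionIn_dihedral hα hu, add_comm]
      rfl
    · simp only [h, if_true, Nat.even_add_one, not_false_iff, if_false]
      rw [reflectionIn_dihedral hα hu', add_comm]
      rfl

/-- A simple root that is not a right descent of `w` is mapped by `w` to a positive root. -/
theorem isNonneg_geometricRep [Fintype B] (cs : CoxeterSystem M W)
    (hα : ∀ i j, b (α i) (α j) = formEntry M i j) (w : W) (s : B)
    (hs : cs.length w < cs.length (w * cs.simple s)) :
    IsNonneg α (geometricRep cs hα w (α s)) := by
  induction hn : cs.length w using Nat.strong_induction_on generalizing w s with
  | _ n ih =>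
  subst hn
  by_cases hw : w = 1
  · subst hw
    simpa using isNonneg_root s
  obtain ⟨t, ht⟩ := cs.exists_rightDescent_of_ne_one hw
  rw [cs.isRightDescent_iff] at ht
  have hst : s ≠ t := by
    rintro rfl
    omega
  let p : ℕ → W := fun k => cs.wordProd (CoxeterSystem.alternatingWord s t k)
  have hplen : ∀ k, cs.length (p k) ≤ k := fun k => by
    simpa using cs.length_wordProd_le (CoxeterSystem.alternatingWord s t k)
  have hpsucc : ∀ k, w * (p (k + 1))⁻¹ =
      w * (p k)⁻¹ * cs.simple (if Even k then t else s) := by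
    intro k
    simp only [p]
    rw [CoxeterSystem.alternatingWord_succ', cs.wordProd_cons, mul_inv_rev, cs.inv_simple,
      mul_assoc]
  have hex : ∃ k, cs.length (w * (p k)⁻¹) + k ≠ cs.length w :=
    ⟨cs.length w + 1, by omega⟩
  classical
  have hspec := Nat.find_spec hex
  have hmin := fun k (hk : k < Nat.find hex) => not_not.1 (Nat.find_min hex hk)
  set k' := Nat.find hex
  clear_value k'
  have h0 : cs.length (w * (p 0)⁻¹) + 0 = cs.length w := by
    simp [p, CoxeterSystem.alternatingWord]
  have h1 : cs.length (w * (p 1)⁻¹) + 1 = cs.length w := by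
    simpa [p, CoxeterSystem.alternatingWord] using ht
  obtain ⟨k, rfl⟩ : ∃ k, k' = k + 2 := by
    have : k' ≠ 0 := by
      intro h
      rw [h] at hspec
      exact hspec h0
    have : k' ≠ 1 := by
      intro h
      rw [h] at hspec
      exact hspec h1
    exact ⟨k' - 2, by omega⟩
  have hkm : M s t ≠ 0 → k + 1 + 1 ≤ M s t := by
    intro hM
    by_contra! hlt
    have hPm := hmin (M s t) (by omega)
    obtain ⟨m, hm⟩ := Nat.exists_eq_succ_of_ne_zero hM
    have hbraid : p (M s t) = cs.wordProd (CoxeterSystem.alternatingWord s t m) * cs.simple s := by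
      have h1 := cs.wordProd_braidWord_eq s t
      rw [CoxeterSystem.braidWord, CoxeterSystem.braidWord, M.symmetric t s, hm,
        CoxeterSystem.alternatingWord_succ t s, cs.wordProd_concat] at h1
      simp only [p]
      rw [hm]
      exact h1
    have hws : w * cs.simple s = w * (p (M s t))⁻¹ *
        cs.wordProd (CoxeterSystem.alternatingWord s t m) := by
      rw [hbraid]
      simp [mul_assoc]
    have h1 := cs.length_mul_le (w * (p (M s t))⁻¹)
      (cs.wordProd (CoxeterSystem.alternatingWord s t m))
    have h2 := hplen m
    rw [← hws] at h1
    simp only [p] at h2 hPm h1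
    omega
  obtain ⟨u, hu0, hu1, hu, hupos, -⟩ := exists_dihedral_coeff (M := M) hst
  obtain ⟨v, hv⟩ : ∃ v, v = w * (p (k + 1))⁻¹ := ⟨_, rfl⟩
  have hvlen : cs.length v + (k + 1) = cs.length w := by
    rw [hv]
    exact hmin (k + 1) (by omega)
  have hvlen' : cs.length (w * (p k)⁻¹) + k = cs.length w := hmin k (by omega)
  have hw' : w = v * p (k + 1) := by simp [hv]
  have hasc₁ : cs.length v < cs.length (v * cs.simple (if Even (k + 1) then t else s)) := by
    rcases cs.length_mul_simple v (if Even (k + 1) then t else s) with h | h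
    · omega
    · refine absurd ?_ hspec
      rw [hpsucc (k + 1), ← hv]
      omega
  have hasc₂ : cs.length v < cs.length (v * cs.simple (if Even k then t else s)) := by
    have : v * cs.simple (if Even k then t else s) = w * (p k)⁻¹ := by
      rw [hv, hpsucc, cs.simple_mul_simple_cancel_right]
    rw [this]
    omega
  have key : ∀ r, r = s ∨ r = t → IsNonneg α (geometricRep cs hα v (α r)) := by
    intro r hr
    refine ih _ (by omega) v r ?_ rfl
    by_cases h : Even k <;> simp only [h, Nat.even_add_one, if_true, if_false, not_true,
      not_false_iff] at hasc₁ hasc₂ <;> rcases hr with rfl | rfl <;> assumption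
  have hku : ∀ j : ℕ, j ≤ k + 1 + 1 → 0 ≤ u j := fun j hj =>
    hupos j fun hM => hj.trans (hkm hM)
  have e := geometricRep_alternatingWord cs hα hu0 hu1 hu (k + 1)
  rw [hw', map_mul, Module.End.mul_apply]
  simp only [p]
  rw [e, map_add, map_smul, map_smul]
  refine ((key _ ?_).smul ?_).add ((key _ ?_).smul ?_)
  · split_ifs <;> simp
  · exact_mod_cast hku (k + 1 + 1) le_rfl
  · split_ifs <;> simp
  · exact hku (k + 1) (by omega)

end PositiveRoots

section Perron

variable {B : Type*} [Fintype B] {M : CoxeterMatrix B}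

theorem bilin_smul_self (c : ℝ) (v : B → ℝ) : bilin M (c • v) (c • v) = c ^ 2 * bilin M v v := by
  simp only [bilin, Finset.mul_sum, Pi.smul_apply, smul_eq_mul]
  exact Finset.sum_congr rfl fun i _ => Finset.sum_congr rfl fun j _ => by ring

theorem bilin_eq_sum (v w : B → ℝ) : bilin M v w = ∑ i, v i * ∑ j, formEntry M i j * w j := by
  simp only [bilin, Finset.mul_sum]
  exact Finset.sum_congr rfl fun i _ => Finset.sum_congr rfl fun j _ => by ring

theorem bilin_comm (v w : B → ℝ) : bilin M v w = bilin M w v := by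
  rw [bilin, bilin, Finset.sum_comm]
  exact Finset.sum_congr rfl fun i _ => Finset.sum_congr rfl fun j _ => by
    rw [formEntry_comm]; ring

theorem bilin_add_smul_self (v w : B → ℝ) (t : ℝ) :
    bilin M (v + t • w) (v + t • w) =
      bilin M v v + 2 * t * bilin M w v + t ^ 2 * bilin M w w := by
  have : bilin M (v + t • w) (v + t • w) =
      bilin M v v + t * bilin M v w + t * bilin M w v + t ^ 2 * bilin M w w := by
    simp only [bilin, Finset.mul_sum, ← Finset.sum_add_distrib, Pi.add_apply, Pi.smul_apply,
      smul_eq_mul]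
    exact Finset.sum_congr rfl fun i _ => Finset.sum_congr rfl fun j _ => by ring
  rw [this, bilin_comm v w]
  ring

theorem bilin_abs_le (v : B → ℝ) : bilin M |v| |v| ≤ bilin M v v := by
  refine Finset.sum_le_sum fun i _ => Finset.sum_le_sum fun j _ => ?_
  rcases eq_or_ne i j with rfl | hij
  · simp [abs_mul_abs_self]
  · rw [Pi.abs_apply, Pi.abs_apply, ← abs_mul]
    exact mul_le_mul_of_nonpos_right (le_abs_self _) (formEntry_nonpos hij)

/-- The bottom eigenvector of the form of a Coxeter matrix is nonnegative. -/
theorem exists_nonneg_eigenvector (hM : ¬ IsPosSemidef M) :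
    ∃ (x : B → ℝ) (r : ℝ), x ≠ 0 ∧ r < 0 ∧ (∀ i, 0 ≤ x i) ∧
      ∀ i, ∑ j, formEntry M i j * x j = r * x i := by
  classical
  rw [IsPosSemidef] at hM
  push Not at hM
  obtain ⟨y, hy⟩ := hM
  have hsq : ∀ v : B → ℝ, v ≠ 0 → 0 < ∑ i, v i ^ 2 := fun v hv => by
    obtain ⟨i, hi⟩ := Function.ne_iff.1 hv
    exact Finset.sum_pos' (fun i _ => sq_nonneg _) ⟨i, Finset.mem_univ _, by
      have : v i ≠ 0 := hi
      positivity⟩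
  have hscale : ∀ v : B → ℝ, v ≠ 0 → ∃ c : ℝ, c ^ 2 * ∑ i, v i ^ 2 = 1 := fun v hv =>
    ⟨(√(∑ i, v i ^ 2))⁻¹, by
      rw [inv_pow, Real.sq_sqrt (hsq v hv).le, inv_mul_cancel₀ (hsq v hv).ne']⟩
  let K : Set (B → ℝ) := {v | ∑ i, v i ^ 2 = 1}
  have hK : IsCompact K := by
    refine isCompact_Icc (a := (-1 : B → ℝ)) (b := 1) |>.of_isClosed_subset
      (isClosed_eq (by fun_prop) (by fun_prop)) fun v hv => ?_
    have h : ∀ i, |v i| ≤ 1 := fun i => by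
      rw [← sq_le_one_iff_abs_le_one, ← show ∑ i, v i ^ 2 = 1 from hv]
      exact Finset.single_le_sum (f := fun i => v i ^ 2) (fun i _ => sq_nonneg _)
        (Finset.mem_univ i)
    exact ⟨fun i => (abs_le.1 (h i)).1, fun i => (abs_le.1 (h i)).2⟩
  have hmem : ∀ (v : B → ℝ) (c : ℝ), c ^ 2 * ∑ i, v i ^ 2 = 1 → c • v ∈ K := fun v c h => by
    simpa [K, mul_pow, ← Finset.mul_sum] using h
  have hy0 : y ≠ 0 := by
    rintro rfl
    simp [bilin] at hy
  obtain ⟨c, hc⟩ := hscale y hy0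
  have hcont : Continuous fun v : B → ℝ => bilin M v v := by
    unfold bilin
    fun_prop
  obtain ⟨z, hz, hmin⟩ := hK.exists_isMinOn ⟨_, hmem y c hc⟩ hcont.continuousOn
  set r := bilin M z z with hr
  have hle : ∀ v : B → ℝ, r * ∑ i, v i ^ 2 ≤ bilin M v v := fun v => by
    rcases eq_or_ne v 0 with rfl | hv
    · simp [bilin]
    obtain ⟨c, hc⟩ := hscale v hv
    have h1 : r ≤ _ := hmin (hmem v c hc)
    simp only at h1
    rw [bilin_smul_self] at h1
    have hc0 : 0 < c ^ 2 := by
      rcases (sq_nonneg c).eq_or_lt with h | h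
      · rw [← h] at hc
        simp at hc
      · exact h
    refine le_of_mul_le_mul_left ?_ hc0
    rwa [mul_left_comm, hc, mul_one]
  have hr0 : r < 0 := by
    have h1 : r ≤ _ := hmin (hmem y c hc)
    simp only at h1
    rw [bilin_smul_self] at h1
    have hc0 : 0 < c ^ 2 := by
      rcases (sq_nonneg c).eq_or_lt with h | h
      · rw [← h] at hc
        simp at hc
      · exact h
    nlinarith
  have hz' : ∑ i, |z| i ^ 2 = 1 := by
    simpa [K] using hz
  have hx0 : |z| ≠ 0 := by
    intro h
    rw [h] at hz'
    simp at hz'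
  have hxq : bilin M |z| |z| = r := le_antisymm (bilin_abs_le z) (by
    have := hle |z|
    rwa [hz', mul_one] at this)
  refine ⟨|z|, r, hx0, hr0, fun i => abs_nonneg _, fun i => ?_⟩
  have hvar : ∀ t : ℝ, 0 ≤ (1 - r) * (t * t) +
      (2 * (∑ j, formEntry M i j * |z| j - r * |z| i)) * t + 0 := fun t => by
    have h1 := hle (|z| + t • Pi.single i 1)
    rw [bilin_add_smul_self, hxq, bilin_eq_sum, bilin_eq_sum] at h1
    have h2 : ∑ j, (|z| + t • Pi.single i 1 : B → ℝ) j ^ 2 = 1 + 2 * t * |z| i + t ^ 2 := by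
      simp only [Pi.add_apply, add_sq, Finset.sum_add_distrib, hz', Pi.smul_apply, smul_eq_mul,
        Pi.single_apply]
      simp
      ring
    rw [h2] at h1
    simp [Pi.single_apply] at h1
    simp only [Pi.abs_apply]
    nlinarith
  have h := discrim_le_zero hvar
  rw [discrim] at h
  nlinarith [sq_nonneg (∑ j, formEntry M i j * |z| j - r * |z| i)]

theorem exists_pos_vector (hirr : IsIrreducible M) (hM : ¬ IsPosSemidef M) :
    ∃ x : B → ℝ, (∀ i, 0 < x i) ∧ ∀ i, ∑ j, formEntry M i j * x j < 0 := by
  obtain ⟨x, r, hx0, hr, hx, heig⟩ := exists_nonneg_eigenvector hM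
  have hadj : ∀ i j, (coxeterGraph M).Adj i j → x i = 0 → x j = 0 := fun i j hij hi => by
    rw [coxeterGraph, SimpleGraph.fromRel_adj] at hij
    have hM2 : M i j ≠ 2 := hij.2.elim id fun h => by rwa [M.symmetric]
    have hterm : ∀ k, formEntry M i k * x k ≤ 0 := fun k => by
      rcases eq_or_ne i k with rfl | hik
      · simp [hi]
      · exact mul_nonpos_of_nonpos_of_nonneg (formEntry_nonpos hik) (hx k)
    have h := heig i
    rw [hi, mul_zero, Finset.sum_eq_zero_iff_of_nonpos fun k _ => hterm k] at h
    exact (mul_eq_zero.1 (h j (Finset.mem_univ j))).resolve_left (formEntry_neg hij.1 hM2).ne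
  have hpos : ∀ i, 0 < x i := fun i => by
    refine (hx i).lt_of_ne' fun hi => hx0 (funext fun j => ?_)
    have := hirr.preconnected i j
    rw [SimpleGraph.reachable_iff_reflTransGen] at this
    induction this with
    | refl => exact hi
    | tail _ h ih => exact hadj _ _ h ih
  exact ⟨x, hpos, fun i => by rw [heig]; exact mul_neg_of_neg_of_pos hr (hpos i)⟩

end Perron

section RootBasis

variable {B E W : Type*} [AddCommGroup E] [Module ℝ E] [Group W] {M : CoxeterMatrix B}
  {b : LinearMap.BilinForm ℝ E} {α : B → E}

theorem geometricRep_invariant (cs : CoxeterSystem M W) (hb : ∀ x y, b x y = b y x)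
    (hα : ∀ i j, b (α i) (α j) = formEntry M i j) (w : W) (x y : E) :
    b (geometricRep cs hα w x) (geometricRep cs hα w y) = b x y := by
  induction w using cs.simple_induction generalizing x y with
  | simple i =>
    rw [geometricRep_simple, form_reflectionIn hb (by rw [hα, formEntry_self])]
  | one => simp
  | mul w w' h h' => rw [map_mul, Module.End.mul_apply, Module.End.mul_apply, h, h']

theorem exists_length_gt [Finite B] [Infinite W] (cs : CoxeterSystem M W) (n : ℕ) :
    ∃ w, n < cs.length w := by
  by_contra! h
  have hfin : {l : List B | l.length ≤ n}.Finite := List.finite_length_le B n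
  refine Set.infinite_univ ((hfin.image cs.wordProd).subset fun w _ => ?_)
  obtain ⟨l, hl, rfl⟩ := cs.exists_isReduced w
  exact ⟨l, by simpa [hl.eq] using h (cs.wordProd l), rfl⟩

variable [Fintype B]

theorem one_le_sum_of_norm_one (hα : ∀ i j, b (α i) (α j) = formEntry M i j) {c : B → ℝ}
    (hc : ∀ i, 0 ≤ c i) (h : b (∑ i, c i • α i) (∑ i, c i • α i) = 1) : 1 ≤ ∑ i, c i := by
  have hle : b (∑ i, c i • α i) (∑ i, c i • α i) ≤ (∑ i, c i) * ∑ i, c i := by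
    simp only [map_sum, map_smul, LinearMap.sum_apply, LinearMap.smul_apply, smul_eq_mul, hα,
      Finset.mul_sum, Finset.sum_mul]
    refine Finset.sum_le_sum fun i _ => Finset.sum_le_sum fun j _ => ?_
    have h1 := mul_nonneg (hc i) (hc j)
    have h2 := (abs_le.1 (abs_formEntry_le_one (M := M) j i)).2
    nlinarith
  have h0 := Finset.sum_nonneg fun i (_ : i ∈ Finset.univ) => hc i
  nlinarith

variable {v : E}

theorem form_root_le (cs : CoxeterSystem M W) (hb : ∀ x y, b x y = b y x)
    (hα : ∀ i j, b (α i) (α j) = formEntry M i j) {m : ℝ} (hm : 0 < m)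
    (hv : ∀ i, b v (α i) ≤ -m) {w : W} {s : B} (hs : cs.length w < cs.length (w * cs.simple s)) :
    b v (geometricRep cs hα w (α s)) ≤ -m := by
  have hnorm := geometricRep_invariant cs hb hα w (α s) (α s)
  obtain ⟨c, hc, h⟩ := isNonneg_geometricRep cs hα w s hs
  rw [hα, formEntry_self, ← h] at hnorm
  have h1 := one_le_sum_of_norm_one hα hc hnorm
  have h2 : b v (∑ i, c i • α i) ≤ ∑ i, c i * -m := by
    simp only [map_sum, map_smul, smul_eq_mul]
    exact Finset.sum_le_sum fun i _ => mul_le_mul_of_nonneg_left (hv i) (hc i)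
  rw [← Finset.sum_mul] at h2
  rw [← h]
  nlinarith

theorem form_orbit_le (cs : CoxeterSystem M W) (hb : ∀ x y, b x y = b y x)
    (hα : ∀ i j, b (α i) (α j) = formEntry M i j) {m : ℝ} (hm : 0 < m)
    (hv : ∀ i, b v (α i) ≤ -m) (w : W) :
    b v (geometricRep cs hα w v) ≤ b v v - 2 * m ^ 2 * cs.length w := by
  induction hn : cs.length w generalizing w with
  | zero =>
    rw [cs.length_eq_zero_iff] at hn
    simp [hn]
  | succ n ih =>
    have hw : w ≠ 1 := by
      rintro rfl
      simp at hn
    obtain ⟨t, ht⟩ := cs.exists_rightDescent_of_ne_one hw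
    rw [cs.isRightDescent_iff] at ht
    obtain ⟨u, rfl⟩ : ∃ u, w = u * cs.simple t := ⟨w * cs.simple t, by simp⟩
    rw [cs.simple_mul_simple_cancel_right] at ht
    have h1 := form_root_le cs hb hα hm hv (w := u) (s := t) (by omega)
    have h2 := ih u (by omega)
    have h3 := hv t
    rw [map_mul, Module.End.mul_apply, geometricRep_simple, reflectionIn_apply]
    simp only [map_sub, map_smul, smul_eq_mul]
    push_cast
    nlinarith

theorem reflectionRep_geometricRep [Infinite W] (cs : CoxeterSystem M W) (hirr : IsIrreducible M)
    (hb : ∀ x y, b x y = b y x) (hnd : ∀ x, (∀ y, b x y = 0) → x = 0)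
    (hα : ∀ i j, b (α i) (α j) = formEntry M i j) (hspan : Submodule.span ℝ (Set.range α) = ⊤)
    {x : B → ℝ} (hx : ∀ i, 0 < x i) (hxα : ∀ i, b (∑ j, x j • α j) (α i) < 0) :
    ReflectionRep b (geometricRep cs hα) cs.simple α (∑ j, x j • α j) := by
  have := hirr.nonempty
  obtain ⟨i₀, hi₀⟩ := Finite.exists_max fun i => b (∑ j, x j • α j) (α i)
  obtain ⟨m, hm, hv⟩ : ∃ m, 0 < m ∧ ∀ i, b (∑ j, x j • α j) (α i) ≤ -m :=
    ⟨_, neg_pos.2 (hxα i₀), fun i => by simpa using hi₀ i⟩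
  have hvv : b (∑ j, x j • α j) (∑ j, x j • α j) < 0 := by
    rw [map_sum (b _)]
    simp only [map_smul, smul_eq_mul]
    exact Finset.sum_neg (fun i _ => mul_neg_of_pos_of_neg (hx i) (hxα i))
      Finset.univ_nonempty
  have hle := form_orbit_le cs hb hα hm hv
  set v := ∑ j, x j • α j
  have hlen : ∀ w, 0 ≤ 2 * m ^ 2 * (cs.length w : ℝ) := fun w => by positivity
  refine ⟨hb, hnd, geometricRep_invariant cs hb hα, fun w hw => ?_, fun i => ?_, fun i j => ?_,
    fun i y => ?_, fun U hU => ?_, hspan, ?_, fun w => ?_, fun C => ?_⟩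
  · have h := hle w
    rw [hw] at h
    have h0 : (cs.length w : ℝ) ≤ 0 := by
      by_contra! h0
      have : 0 < 2 * m ^ 2 * (cs.length w : ℝ) := by positivity
      linarith
    rw [← cs.length_eq_zero_iff]
    exact_mod_cast le_antisymm h0 (Nat.cast_nonneg _)
  · rw [hα, formEntry_self]
  · rw [hα]
    exact abs_formEntry_le_one i j
  · rw [geometricRep_simple, reflectionIn_apply]
  · have hdich : ∀ i, α i ∈ U ∨ ∀ y ∈ U, b y (α i) = 0 := fun i => by
      rw [or_iff_not_imp_right]
      intro h
      push Not at h
      obtain ⟨y, hy, hyi⟩ := h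
      have h1 := U.sub_mem hy (hU i y hy)
      rw [geometricRep_simple, reflectionIn_apply, sub_sub_cancel] at h1
      exact (U.smul_mem_iff (by simpa using hyi)).1 h1
    have hadj : ∀ i j, (coxeterGraph M).Adj i j → α i ∈ U → α j ∈ U := fun i j hij hi => by
      rw [coxeterGraph, SimpleGraph.fromRel_adj] at hij
      have hM2 : M i j ≠ 2 := hij.2.elim id fun h => by rwa [M.symmetric]
      refine (hdich j).resolve_right fun h => (formEntry_neg hij.1 hM2).ne ?_
      rw [← hα]
      exact h _ hi
    by_cases hex : ∃ i, α i ∈ U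
    · obtain ⟨i, hi⟩ := hex
      right
      rw [eq_top_iff, ← hspan, Submodule.span_le]
      rintro _ ⟨j, rfl⟩
      have := hirr.preconnected i j
      rw [SimpleGraph.reachable_iff_reflTransGen] at this
      induction this with
      | refl => exact hi
      | tail _ h ih => exact hadj _ _ h ih
    · left
      push Not at hex
      rw [eq_bot_iff]
      intro y hy
      refine hnd y fun z => ?_
      have hz : z ∈ Submodule.span ℝ (Set.range α) := hspan ▸ Submodule.mem_top
      have hker : Submodule.span ℝ (Set.range α) ≤ LinearMap.ker (b y) := by
        rw [Submodule.span_le]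
        rintro _ ⟨j, rfl⟩
        exact ((hdich j).resolve_left (hex j)) y hy
      exact hker hz
  · intro h
    rw [h] at hvv
    simp at hvv
  · linarith [hle w, hlen w]
  · obtain ⟨n, hn⟩ := exists_nat_gt (C / (2 * m ^ 2))
    obtain ⟨w, hw⟩ := exists_length_gt cs n
    refine ⟨w, ?_⟩
    have h1 : (n : ℝ) < cs.length w := by exact_mod_cast hw
    rw [div_lt_iff₀ (by positivity)] at hn
    have h2 := hle w
    have : (n : ℝ) * (2 * m ^ 2) < cs.length w * (2 * m ^ 2) := by gcongr
    linarith

end RootBasis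

section RadicalQuotient

variable {B : Type*} [Fintype B] (M : CoxeterMatrix B)

/-- The standard bilinear form of a Coxeter matrix. -/
noncomputable def stdForm [DecidableEq B] : LinearMap.BilinForm ℝ (B → ℝ) :=
  Matrix.toBilin' (Matrix.of (formEntry M))

theorem stdForm_comm [DecidableEq B] (x y : B → ℝ) : stdForm M x y = stdForm M y x := by
  simp only [stdForm, Matrix.toBilin'_apply, Matrix.of_apply]
  rw [Finset.sum_comm]
  exact Finset.sum_congr rfl fun i _ => Finset.sum_congr rfl fun j _ => by
    rw [formEntry_comm]; ring

theorem stdForm_single [DecidableEq B] (i j : B) :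
    stdForm M (Pi.single i 1) (Pi.single j 1) = formEntry M i j := by
  rw [stdForm, Matrix.toBilin'_single, Matrix.of_apply]

variable {M} {W : Type*} [Group W]

/-- Two commuting subgroups of an infinite irreducible Coxeter group of indefinite type that are
normalized by a subgroup of finite index cannot both be nontrivial. -/
theorem eq_bot_or_eq_bot_of_commute [Infinite W] (cs : CoxeterSystem M W)
    (hirr : IsIrreducible M) (hM : ¬ IsPosSemidef M) (Γ A C : Subgroup W) [Γ.FiniteIndex]
    (hA : ∀ γ ∈ Γ, ∀ a ∈ A, γ * a * γ⁻¹ ∈ A) (hC : ∀ γ ∈ Γ, ∀ a ∈ C, γ * a * γ⁻¹ ∈ C)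
    (hAC : ∀ a ∈ A, ∀ c ∈ C, a * c = c * a) : A = ⊥ ∨ C = ⊥ := by
  classical
  let N := LinearMap.ker (stdForm M)
  have hN : N ≤ LinearMap.ker (stdForm M).flip := fun x hx => by
    rw [LinearMap.mem_ker] at hx ⊢
    ext y
    simp [stdForm_comm M _ x, hx]
  let b : LinearMap.BilinForm ℝ ((B → ℝ) ⧸ N) := (stdForm M).liftQ₂ N N le_rfl hN
  let α : B → (B → ℝ) ⧸ N := fun i => N.mkQ (Pi.single i 1)
  have hb : ∀ x y, b x y = b y x := by
    rintro ⟨x⟩ ⟨y⟩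
    exact stdForm_comm M x y
  have hnd : ∀ x, (∀ y, b x y = 0) → x = 0 := by
    rintro ⟨x⟩ h
    refine (Submodule.Quotient.mk_eq_zero N).2 ?_
    ext y
    exact h (N.mkQ (Pi.single y 1))
  have hα : ∀ i j, b (α i) (α j) = formEntry M i j := stdForm_single M
  have hspan : Submodule.span ℝ (Set.range α) = ⊤ := by
    have : Set.range α = N.mkQ '' Set.range (Pi.basisFun ℝ B) := by
      rw [← Set.range_comp]
      exact congrArg _ (funext fun i => by simp [α])
    rw [this, Submodule.span_image, Module.Basis.span_eq, Submodule.map_top, Submodule.range_mkQ]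
  obtain ⟨x, hx, hxM⟩ := exists_pos_vector hirr hM
  have hxα : ∀ i, b (∑ j, x j • α j) (α i) < 0 := fun i => by
    rw [hb]
    simp only [map_sum, map_smul, hα, smul_eq_mul]
    simpa only [mul_comm] using hxM i
  exact (reflectionRep_geometricRep cs hirr hb hnd hα hspan hx hxα).eq_bot_or_eq_bot_of_commute
    Γ A C hA hC hAC

end RadicalQuotient

/-- A family of homomorphisms that is jointly injective, and each of whose members is nontrivial
and trivial on one of any two commuting normal subgroups. -/
structure IsSplitting {H ι : Type*} [Group H] {W : ι → Type*} [∀ i, Group (W i)]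
    (p : ∀ i, H →* W i) : Prop where
  eq_one : ∀ h, (∀ i, p i h = 1) → h = 1
  exists_ne_one : ∀ i, ∃ h, p i h ≠ 1
  trivial_or_trivial : ∀ A C : Subgroup H, A.Normal → C.Normal →
    (∀ a ∈ A, ∀ c ∈ C, Commute a c) → ∀ i, (∀ a ∈ A, p i a = 1) ∨ ∀ c ∈ C, p i c = 1

/-- A family of pairwise disjoint normal subgroups that generate the group. -/
structure IsNormalPartition {H κ : Type*} [Group H] (K : κ → Subgroup H) : Prop where
  normal : ∀ i, (K i).Normal
  disjoint : ∀ i j, i ≠ j → Disjoint (K i) (K j)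
  iSup_eq_top : ⨆ i, K i = ⊤

theorem IsInternalDirectProduct.isNormalPartition {H κ : Type*} [Group H] {K : κ → Subgroup H}
    (hK : IsInternalDirectProduct K) : IsNormalPartition K :=
  ⟨hK.1, fun i _ hij => (disjoint_iff.2 (hK.2.2 i)).mono_right (le_biSup K hij.symm), hK.2.1⟩

namespace IsNormalPartition

variable {H κ : Type*} [Group H] {K : κ → Subgroup H} (hK : IsNormalPartition K)
include hK

theorem commute {i j : κ} (hij : i ≠ j) {x y : H} (hx : x ∈ K i) (hy : y ∈ K j) : Commute x y :=
  Subgroup.commute_of_normal_of_disjoint _ _ (hK.normal i) (hK.normal j) (hK.disjoint i j hij)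
    x y hx hy

theorem commute_iSup (i : κ) {x y : H} (hx : x ∈ K i) (hy : y ∈ ⨆ j ∈ {j | j ≠ i}, K j) :
    Commute x y := by
  have : ⨆ j ∈ {j | j ≠ i}, K j ≤ Subgroup.centralizer {x} :=
    iSup₂_le fun j hj z hz => Subgroup.mem_centralizer_singleton_iff.2
      (hK.commute (Ne.symm hj) hx hz).eq.symm
  exact (Subgroup.mem_centralizer_singleton_iff.1 (this hy)).symm

theorem normal_iSup (i : κ) : (⨆ j ∈ {j | j ≠ i}, K j).Normal :=
  have := hK.normal
  inferInstance

theorem exists_mul (i : κ) (h : H) : ∃ a ∈ K i, ∃ c ∈ ⨆ j ∈ {j | j ≠ i}, K j, a * c = h := by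
  have := hK.normal i
  rw [← Subgroup.mem_sup_of_normal_left]
  have : K i ⊔ ⨆ j ∈ {j | j ≠ i}, K j = ⊤ := by
    rw [eq_top_iff, ← hK.iSup_eq_top]
    refine iSup_le fun j => ?_
    rcases eq_or_ne j i with rfl | hj
    · exact le_sup_left
    · exact (le_biSup K (i := j) hj).trans le_sup_right
  rw [this]
  exact Subgroup.mem_top h

/-- A normal subgroup of a factor is normal in the whole group. -/
theorem normal_map (i : κ) (A : Subgroup (K i)) [A.Normal] : (A.map (K i).subtype).Normal := by
  refine ⟨?_⟩
  rintro _ ⟨x, hx, rfl⟩ h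
  obtain ⟨a, ha, c, hc, rfl⟩ := hK.exists_mul i h
  refine ⟨⟨a, ha⟩ * x * ⟨a, ha⟩⁻¹, Subgroup.Normal.conj_mem ‹_› x hx _, ?_⟩
  have : c * x * c⁻¹ = x := by
    rw [← (hK.commute_iSup i x.2 hc).eq, mul_inv_cancel_right]
  simp only [Subgroup.subtype_apply, Subgroup.coe_mul, InvMemClass.coe_inv, mul_inv_rev]
  conv_lhs => rw [← this]
  group

end IsNormalPartition

namespace IsSplitting

variable {H ι : Type*} [Group H] {W : ι → Type*} [∀ i, Group (W i)] {p : ∀ i, H →* W i}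
  (hp : IsSplitting p)
include hp

theorem center_eq_bot : Subgroup.center H = ⊥ := by
  refine (Subgroup.eq_bot_iff_forall _).2 fun z hz => hp.eq_one z fun i => ?_
  obtain ⟨h, hh⟩ := hp.exists_ne_one i
  refine (hp.trivial_or_trivial (Subgroup.center H) ⊤ inferInstance inferInstance
    (fun a ha c _ => (Subgroup.mem_center_iff.1 ha c).symm) i).resolve_right (fun h' => ?_) z hz
  exact hh (h' h (Subgroup.mem_top h))

variable {κ : Type*} {K : κ → Subgroup H}

theorem isInternalDirectProduct (hK : IsNormalPartition K) : IsInternalDirectProduct K := by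
  refine ⟨hK.normal, hK.iSup_eq_top, fun i => (Subgroup.eq_bot_iff_forall _).2 fun x hx =>
    hp.eq_one x fun l => ?_⟩
  rw [Subgroup.mem_inf] at hx
  rcases hp.trivial_or_trivial _ _ (hK.normal i) (hK.normal_iSup i)
    (fun a ha c hc => hK.commute_iSup i ha hc) l with h | h
  · exact h x hx.1
  · exact h x hx.2

/-- A factor consists of the elements supported where the factor is. -/
theorem mem_factor (hK : IsNormalPartition K) {i : κ} {h : H}
    (hh : ∀ l, (∀ a ∈ K i, p l a = 1) → p l h = 1) : h ∈ K i := by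
  obtain ⟨a, ha, c, hc, rfl⟩ := hK.exists_mul i h
  have : c = 1 := hp.eq_one c fun l => by
    rcases hp.trivial_or_trivial _ _ (hK.normal i) (hK.normal_iSup i)
      (fun a ha c hc => hK.commute_iSup i ha hc) l with h | h
    · simpa [h a ha] using hh l h
    · exact h c hc
  simpa [this] using ha

theorem card_le [Fintype κ] [Fintype ι] (hK : IsNormalPartition K) (hne : ∀ i, K i ≠ ⊥) :
    Fintype.card κ ≤ Fintype.card ι := by
  have hex : ∀ i, ∃ l, ∃ a ∈ K i, p l a ≠ 1 := fun i => by
    by_contra! h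
    exact hne i ((Subgroup.eq_bot_iff_forall _).2 fun x hx => hp.eq_one x fun l => h l x hx)
  choose f a ha hfa using hex
  refine Fintype.card_le_of_injective f fun i j hij => ?_
  by_contra hne
  rcases hp.trivial_or_trivial _ _ (hK.normal i) (hK.normal j)
    (fun a ha c hc => hK.commute hne ha hc) (f i) with h | h
  · exact hfa i (h _ (ha i))
  · exact hfa j (hij ▸ h _ (ha j))

variable {κ' : Type*} {K' : κ' → Subgroup H}

theorem exists_le (hK : IsNormalPartition K) (hK' : IsNormalPartition K') {i : κ'}
    (hne : K' i ≠ ⊥) (hind : Indecomposable (K' i)) : ∃ j, K' i ≤ K j := by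
  by_contra! hle
  have hdisj : ∀ j, Disjoint (K' i) (K j) := fun j => by
    have hn := hK.normal j
    have hn' := hK.normal_iSup j
    set C := ⨆ l ∈ {l | l ≠ j}, K l
    have hdich := hp.trivial_or_trivial _ _ hn hn' (fun a ha c hc => hK.commute_iSup j ha hc)
    have hfactor : ∀ x ∈ K' i, ∃ a ∈ K j, ∃ c ∈ C, a * c = x ∧ a ∈ K' i ∧ c ∈ K' i :=
      fun x hx => by
        obtain ⟨a, ha, c, hc, rfl⟩ := hK.exists_mul j x
        have ha' : a ∈ K' i := hp.mem_factor hK' fun l hl => by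
          rcases hdich l with h | h
          · exact h a ha
          · simpa [h c hc] using hl _ hx
        exact ⟨a, ha, c, hc, rfl, ha', by simpa using mul_mem (inv_mem ha') hx⟩
    have hKC : K j ⊓ C = ⊥ := (hp.isInternalDirectProduct hK).2.2 j
    have hsplit := hind ((K j).subgroupOf (K' i)) (C.subgroupOf (K' i)) inferInstance inferInstance
      ?_ ?_
    · rw [Subgroup.subgroupOf_eq_bot, Subgroup.subgroupOf_eq_bot] at hsplit
      refine (hsplit.resolve_right fun h => hle j fun x hx => ?_).symm
      obtain ⟨a, ha, c, hc, rfl, -, hc'⟩ := hfactor x hx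
      rw [Subgroup.disjoint_def.1 h hc hc', mul_one]
      exact ha
    · rw [Subgroup.subgroupOf, Subgroup.subgroupOf, ← Subgroup.comap_inf, hKC]
      exact Subgroup.bot_subgroupOf _
    · rw [eq_top_iff]
      rintro ⟨x, hx⟩ -
      obtain ⟨a, ha, c, hc, rfl, ha', hc'⟩ := hfactor x hx
      exact Subgroup.mul_mem_sup (x := (⟨a, ha'⟩ : K' i)) (y := (⟨c, hc'⟩ : K' i)) ha hc
  refine hne ((Subgroup.eq_bot_iff_forall _).2 fun x hx => ?_)
  have hx' : x ∈ Subgroup.center H := by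
    have : ⨆ j, K j ≤ Subgroup.centralizer {x} := iSup_le fun j y hy =>
      Subgroup.mem_centralizer_singleton_iff.2 (Subgroup.commute_of_normal_of_disjoint _ _
        (hK'.normal i) (hK.normal j) (hdisj j) x y hx hy).eq.symm
    rw [hK.iSup_eq_top] at this
    exact Subgroup.mem_center_iff.2 fun y =>
      Subgroup.mem_centralizer_singleton_iff.1 (this (Subgroup.mem_top y))
  rwa [hp.center_eq_bot, Subgroup.mem_bot] at hx'

theorem exists_equiv (hK : IsNormalPartition K) (hne : ∀ j, K j ≠ ⊥)
    (hind : ∀ j, Indecomposable (K j)) (hK' : IsNormalPartition K') (hne' : ∀ i, K' i ≠ ⊥)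
    (hind' : ∀ i, Indecomposable (K' i)) : ∃ e : κ' ≃ κ, ∀ i, K' i = K (e i) := by
  choose e he using fun i => hp.exists_le hK hK' (hne' i) (hind' i)
  choose f hf using fun j => hp.exists_le hK' hK (hne j) (hind j)
  have hfe : ∀ i, f (e i) = i := fun i => by
    by_contra h
    exact hne' i (disjoint_self.1
      ((hK'.disjoint _ _ h).symm.mono_right ((he i).trans (hf (e i)))))
  have hef : ∀ j, e (f j) = j := fun j => by
    by_contra h
    exact hne j (disjoint_self.1 ((hK.disjoint _ _ h).symm.mono_right ((hf j).trans (he (f j)))))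
  exact ⟨⟨e, f, hfe, hef⟩, fun i => (he i).antisymm (by simpa [hfe] using hf (e i))⟩

end IsSplitting

/-- Splitting a decomposable factor yields a partition with one more factor. -/
theorem IsNormalPartition.exists_refinement {H : Type*} [Group H] {m : ℕ}
    {K : Fin m → Subgroup H} (hK : IsNormalPartition K) (hne : ∀ i, K i ≠ ⊥) {i : Fin m}
    (hi : ¬ Indecomposable (K i)) :
    ∃ K' : Fin (m + 1) → Subgroup H, IsNormalPartition K' ∧ ∀ j, K' j ≠ ⊥ := by
  rw [Indecomposable] at hi
  push Not at hi
  obtain ⟨A, C, hA, hC, hinf, hsup, hA0, hC0⟩ := hi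
  have hnA := hK.normal_map i A
  have hnC := hK.normal_map i C
  have hle : ∀ A : Subgroup (K i), A.map (K i).subtype ≤ K i := Subgroup.map_subtype_le
  have hbot : ∀ A : Subgroup (K i), A ≠ ⊥ → A.map (K i).subtype ≠ ⊥ := fun A h h' => h <| by
    rwa [Subgroup.map_eq_bot_iff_of_injective _ (K i).subtype_injective] at h'
  have hdisj : Disjoint (A.map (K i).subtype) (C.map (K i).subtype) := by
    rw [disjoint_iff, ← Subgroup.map_inf _ _ _ (K i).subtype_injective, hinf, Subgroup.map_bot]
  have htop : A.map (K i).subtype ⊔ C.map (K i).subtype = K i := by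
    rw [← Subgroup.map_sup, hsup, ← MonoidHom.range_eq_map, Subgroup.range_subtype]
  have hmem : ∀ j, Function.update K i (C.map (K i).subtype) j ≤ K j := fun j => by
    rcases eq_or_ne j i with rfl | hj
    · simpa using hle C
    · simp [hj]
  have hAj : ∀ j, Disjoint (A.map (K i).subtype)
      (Function.update K i (C.map (K i).subtype) j) := fun j => by
    rcases eq_or_ne j i with rfl | hj
    · simpa using hdisj
    · simpa [hj] using (hK.disjoint i j hj.symm).mono_left (hle A)
  refine ⟨Fin.cons (A.map (K i).subtype) (Function.update K i (C.map (K i).subtype)),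
    ⟨?_, ?_, ?_⟩, ?_⟩
  · refine Fin.cases hnA fun j => ?_
    rcases eq_or_ne j i with rfl | hj
    · simpa using hnC
    · simpa [hj] using hK.normal j
  · refine Fin.cases (Fin.cases (fun h => absurd rfl h) fun j _ => hAj j) fun j =>
      Fin.cases (fun _ => (hAj j).symm) fun l hjl => ?_
    exact (hK.disjoint j l fun h => hjl (h ▸ rfl)).mono (hmem j) (hmem l)
  · rw [eq_top_iff, ← hK.iSup_eq_top]
    refine iSup_le fun j => ?_
    rcases eq_or_ne j i with rfl | hj
    · refine htop.ge.trans (sup_le ?_ ?_)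
      · exact le_iSup_of_le 0 le_rfl
      · exact le_iSup_of_le j.succ (by simp)
    · exact le_iSup_of_le j.succ (by simp [hj])
  · refine Fin.cases (hbot A hA0) fun j => ?_
    rcases eq_or_ne j i with rfl | hj
    · simpa using hbot C hC0
    · simpa [hj] using hne j

/-- The projections from a finite index subgroup of a product of infinite irreducible Coxeter
groups of indefinite type. -/
theorem isSplitting_eval {ι : Type*} {B : ι → Type*} {W : ι → Type*} [∀ i, Fintype (B i)]
    [∀ i, Group (W i)] {M : ∀ i, CoxeterMatrix (B i)} (cs : ∀ i, CoxeterSystem (M i) (W i))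
    (hirr : ∀ i, IsIrreducible (M i)) (hinf : ∀ i, Infinite (W i))
    (hM : ∀ i, ¬ IsPosSemidef (M i)) (H : Subgroup (∀ i, W i)) [H.FiniteIndex] :
    IsSplitting fun i => (Pi.evalMonoidHom W i).comp H.subtype := by
  classical
  have hfin : ∀ i, ((Pi.evalMonoidHom W i).comp H.subtype).range.FiniteIndex := fun i => by
    rw [MonoidHom.range_comp, Subgroup.range_subtype]
    have hsurj : Function.Surjective (Pi.evalMonoidHom W i) := Function.surjective_eval i
    exact ⟨ne_zero_of_dvd_ne_zero Subgroup.FiniteIndex.index_ne_zero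
      (H.index_map_dvd hsurj)⟩
  refine ⟨fun h hh => Subtype.ext (funext hh), fun i => ?_, fun A C hA hC hAC i => ?_⟩
  · by_contra! h
    have hbot : ((Pi.evalMonoidHom W i).comp H.subtype).range = ⊥ := by
      rw [MonoidHom.range_eq_bot_iff]
      exact MonoidHom.ext h
    have hi := (hfin i).index_ne_zero
    rw [hbot, Subgroup.index_bot] at hi
    exact hi Nat.card_eq_zero_of_infinite
  · have hfi := hfin i
    set f := (Pi.evalMonoidHom W i).comp H.subtype
    have hnorm : ∀ A : Subgroup H, A.Normal → ∀ γ ∈ f.range, ∀ a ∈ A.map f,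
        γ * a * γ⁻¹ ∈ A.map f := by
      rintro A hA _ ⟨γ, rfl⟩ _ ⟨a, ha, rfl⟩
      exact ⟨γ * a * γ⁻¹, hA.conj_mem a ha γ, by simp⟩
    have htriv : ∀ A : Subgroup H, A.map f = ⊥ → ∀ a ∈ A, f a = 1 := fun A h a ha => by
      rw [← Subgroup.mem_bot, ← h]
      exact Subgroup.mem_map_of_mem f ha
    refine (eq_bot_or_eq_bot_of_commute (cs i) (hirr i) (hM i) f.range (A.map f) (C.map f)
      (hnorm A hA) (hnorm C hC) ?_).imp (htriv A) (htriv C)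
    rintro _ ⟨a, ha, rfl⟩ _ ⟨c, hc, rfl⟩
    exact ((hAC a ha c hc).map f).eq

/-- If `G` is a direct product of `n` irreducible, infinite,
non-affine Coxeter groups, then any finite index subgroup `H` of `G` has trivial
center, and `H` is, uniquely up to rearrangement of the factors, an internal direct
product of `m` nontrivial indecomposable subgroups, with `1 ≤ m ≤ n`. -/
theorem finiteIndex_subgroup_of_product_unique_decomposition
    {n : ℕ} (hn : 0 < n) {B : Fin n → Type*} {W : Fin n → Type*}
    [∀ i, Fintype (B i)] [∀ i, Group (W i)] {M : ∀ i, CoxeterMatrix (B i)}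
    (cs : ∀ i, CoxeterSystem (M i) (W i))
    (hirr : ∀ i, IsIrreducible (M i)) (hinf : ∀ i, Infinite (W i))
    (hnonaff : ∀ i, ¬ IsPosDef (M i) ∧ ¬ IsPosSemidef (M i))
    (H : Subgroup (∀ i, W i)) (hH : H.FiniteIndex) :
    Subgroup.center H = ⊥ ∧
    ∃ (m : ℕ) (K : Fin m → Subgroup H),
      1 ≤ m ∧ m ≤ n ∧
      (∀ i, K i ≠ ⊥) ∧ IsInternalDirectProduct K ∧ (∀ i, Indecomposable (K i)) ∧
      (∀ (m' : ℕ) (K' : Fin m' → Subgroup H),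
        (∀ i, K' i ≠ ⊥) → IsInternalDirectProduct K' → (∀ i, Indecomposable (K' i)) →
        ∃ e : Fin m' ≃ Fin m, ∀ i, K' i = K (e i)) := by
  have hp := isSplitting_eval cs hirr hinf (fun i => (hnonaff i).2) H
  classical
  let P : ℕ → Prop := fun m =>
    ∃ K : Fin m → Subgroup H, IsNormalPartition K ∧ ∀ i, K i ≠ ⊥
  have hle : ∀ m, P m → m ≤ n := by
    rintro m ⟨K, hK, hne⟩
    simpa using hp.card_le hK hne
  have hone : P 1 := by
    refine ⟨fun _ => ⊤, ⟨fun _ => inferInstance, fun i j hij => absurd (Subsingleton.elim i j) hij,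
      by simp⟩, fun _ h => ?_⟩
    obtain ⟨x, hx⟩ := hp.exists_ne_one ⟨0, hn⟩
    have : x = 1 := by
      rw [← Subgroup.mem_bot, ← h]
      exact Subgroup.mem_top x
    exact hx (by rw [this, map_one])
  obtain ⟨K, hK, hne⟩ : P (Nat.findGreatest P n) := Nat.findGreatest_spec (hle 1 hone) hone
  have hind : ∀ i, Indecomposable (K i) := fun i => by
    by_contra hi
    have hP : P (Nat.findGreatest P n + 1) := hK.exists_refinement hne hi
    have h' := Nat.le_findGreatest (hle _ hP) hP
    omega
  exact ⟨hp.center_eq_bot, _, K, Nat.le_findGreatest (hle 1 hone) hone, Nat.findGreatest_le n, hne,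
    hp.isInternalDirectProduct hK, hind, fun m' K' hne' hK' hind' =>
      hp.exists_equiv hK hne hind hK'.isNormalPartition hne' hind'⟩

end CoxeterPaper
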